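/- Let μ_∅ be a probability measure on ℕ with finite mean and μ a critical aperiodic probability measure on ℤ₊ belonging to the domain of attraction of a stable law of index α ∈ (1,2]. For a plane tree τ, let M(τ) be the size of the largest subtree grafted on a child of the root and N_0(τ) the number of children of the root. Let (Y_i)_{i≥1} be i.i.d. with ℙ(Y_1 = m) = BGW^μ(|τ| = m). Then for every fixed k ≥ 0 and L ≥ 1, BGW_n^{μ_∅,μ}(n − 1 − M = k, N_0 = L) → ℙ(Y_1 + … + Y_{L−1} = k) · L μ_∅(L)/Σ_{j≥1} j μ_∅(j) as n → ∞ (for L = 1 the empty sum is 0, so the first factor is 1_{k=0}). -/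

import Mathlib

open Filter Set

noncomputable section

/-- A plane tree in Neveu's formalism: a finite set of finite words of positive integers,
containing the root `[]`, closed under prefixes, and such that the children of a vertex `u`
are `u1, …, u k_u`. -/
structure PlaneTree where
  verts : Finset (List ℕ)
  root_mem : [] ∈ verts
  prefix_closed : ∀ u v : List ℕ, u <+: v → v ∈ verts → u ∈ verts
  labels_pos : ∀ u ∈ verts, ∀ i ∈ u, 1 ≤ i
  children_closed : ∀ (u : List ℕ) (i : ℕ), 1 ≤ i → u ++ [i + 1] ∈ verts → u ++ [i] ∈ verts

namespace PlaneTree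

/-- The number of children of the vertex `u` in `τ`. -/
def kc (τ : PlaneTree) (u : List ℕ) : ℕ := Set.ncard {i : ℕ | u ++ [i] ∈ τ.verts}

/-- The number of vertices of the subtree grafted on `u` (that is, `u` and its descendants). -/
def subtreeSize (τ : PlaneTree) (u : List ℕ) : ℕ :=
  Set.ncard {v : List ℕ | v ∈ τ.verts ∧ u <+: v}

/-- `M(τ)`: the size of the largest subtree grafted on a child of the root of `τ`. -/
def maxSub (τ : PlaneTree) : ℕ := (Finset.Icc 1 (τ.kc [])).sup fun i => τ.subtreeSize [i]

end PlaneTree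

/-- The Bienaymé–Galton–Watson weight `BGW^μ(τ) = ∏_{u ∈ τ} μ(k_u)` of a plane tree. -/
def bgwW (μ : ℕ → ℝ) (τ : PlaneTree) : ℝ := ∏ u ∈ τ.verts, μ (τ.kc u)

/-- The modified Bienaymé–Galton–Watson weight of a plane tree: the root reproduces according
to `μ0` and the other vertices according to `μ`. -/
def bgwModW (μ0 μ : ℕ → ℝ) (τ : PlaneTree) : ℝ :=
  μ0 (τ.kc []) * ∏ u ∈ τ.verts.erase [], μ (τ.kc u)

/-- The total mass `BGW^{μ0,μ}(T_n)` given by the modified Bienaymé–Galton–Watson measure to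
plane trees with `n` vertices. -/
def bgwModMass (μ0 μ : ℕ → ℝ) (n : ℕ) : ℝ :=
  ∑ᶠ τ ∈ {τ : PlaneTree | τ.verts.card = n}, bgwModW μ0 μ τ

/-- `μ` belongs to the domain of attraction of a stable law of index `α ∈ (1,2]`: either
`α = 2` and `μ` has finite variance, or `α < 2` and the tail `μ([n,∞))` equals `g(n) n^{-α}`
for a slowly varying function `g`. -/
def DomAttr (μ : ℕ → ℝ) (α : ℝ) : Prop :=
  (α = 2 ∧ Summable fun k : ℕ => (k : ℝ) ^ 2 * μ k) ∨
  (α < 2 ∧ ∃ g : ℝ → ℝ, (∀ x : ℝ, 0 < x → 0 < g x) ∧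
    (∀ c : ℝ, 0 < c → Tendsto (fun x => g (c * x) / g x) atTop (nhds 1)) ∧
    ∀ n : ℕ, 1 ≤ n → (∑' k : ℕ, {m : ℕ | n ≤ m}.indicator μ k) = g n * (n : ℝ) ^ (-α))

section

open Filter Set

noncomputable section

namespace PlaneTree

theorem ext_verts {a b : PlaneTree} (h : a.verts = b.verts) : a = b := by
  cases a; cases b; simp_all

theorem downclosed_eq_Icc (S : Set ℕ) (hfin : S.Finite) (hpos : ∀ i ∈ S, 1 ≤ i)
    (hdc : ∀ i, 1 ≤ i → i + 1 ∈ S → i ∈ S) : S = Set.Icc 1 S.ncard := by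
  have hdown : ∀ d i, 1 ≤ i → i + d ∈ S → i ∈ S := by
    intro d
    induction d with
    | zero => intro i _ h; simpa using h
    | succ d ih => intro i hi h; exact ih i hi (hdc _ (by omega) h)
  have : ∃ m, S = Set.Icc 1 m := by
    rcases S.eq_empty_or_nonempty with h | h
    · exact ⟨0, by rw [h]; ext; simp⟩
    · obtain ⟨m, hm, hmax⟩ := hfin.exists_maximal h
      refine ⟨m, ?_⟩
      ext i
      constructor
      · intro hi
        refine ⟨hpos i hi, ?_⟩
        by_contra hc
        have := hmax hi (by omega)
        omega
      · rintro ⟨h1, h2⟩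
        exact hdown (m - i) i h1 (by rwa [Nat.add_sub_cancel' h2])
  obtain ⟨m, hm⟩ := this
  have hc : S.ncard = m := by
    rw [hm, ← Finset.coe_Icc, Set.ncard_coe_finset]; simp
  rw [hc]; exact hm

theorem children_finite (τ : PlaneTree) (u : List ℕ) : {i : ℕ | u ++ [i] ∈ τ.verts}.Finite := by
  refine Set.Finite.preimage (f := fun i : ℕ => u ++ [i]) (s := (τ.verts : Set (List ℕ))) ?_
    τ.verts.finite_toSet
  intro a _ b _ h
  simpa using h

theorem mem_child_iff (τ : PlaneTree) (u : List ℕ) (i : ℕ) :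
    u ++ [i] ∈ τ.verts ↔ 1 ≤ i ∧ i ≤ τ.kc u := by
  have := downclosed_eq_Icc {i : ℕ | u ++ [i] ∈ τ.verts} (τ.children_finite u)
    (fun i hi => τ.labels_pos _ hi i (by simp)) (fun i hi h => τ.children_closed u i hi h)
  have h2 : i ∈ {i : ℕ | u ++ [i] ∈ τ.verts} ↔ i ∈ Set.Icc 1 (τ.kc u) := by
    rw [kc, ← this]
  exact h2

theorem kc_eq_of_iff (τ : PlaneTree) (u : List ℕ) (k : ℕ)
    (h : ∀ i, u ++ [i] ∈ τ.verts ↔ 1 ≤ i ∧ i ≤ k) : τ.kc u = k := by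
  have : {i : ℕ | u ++ [i] ∈ τ.verts} = (Finset.Icc 1 k : Finset ℕ) := by
    ext i; simp [h]
  rw [kc, this, Set.ncard_coe_finset]; simp

/-- Vertex set of the tree obtained by grafting a forest on a root. -/
def graftVerts {k : ℕ} (G : Fin k → PlaneTree) : Finset (List ℕ) :=
  insert [] (Finset.univ.biUnion fun i : Fin k => (G i).verts.image (List.cons (i.val + 1)))

theorem nil_mem_graftVerts {k : ℕ} (G : Fin k → PlaneTree) : [] ∈ graftVerts G := by
  simp [graftVerts]

theorem cons_mem_graftVerts {k : ℕ} (G : Fin k → PlaneTree) (a : ℕ) (v : List ℕ) :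
    a :: v ∈ graftVerts G ↔ ∃ i : Fin k, a = i.val + 1 ∧ v ∈ (G i).verts := by
  simp only [graftVerts, Finset.mem_insert, reduceCtorEq, Finset.mem_biUnion, Finset.mem_univ,
    Finset.mem_image, List.cons.injEq, true_and, false_or]
  constructor
  · rintro ⟨i, w, hw, h1, rfl⟩; exact ⟨i, h1.symm, hw⟩
  · rintro ⟨i, h1, hw⟩; exact ⟨i, v, hw, h1.symm, rfl⟩

/-- Graft a forest on a root. -/
def graft {k : ℕ} (G : Fin k → PlaneTree) : PlaneTree where
  verts := graftVerts G
  root_mem := nil_mem_graftVerts G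
  prefix_closed := by
    intro u v huv hv
    cases u with
    | nil => exact nil_mem_graftVerts G
    | cons a u =>
      obtain ⟨t, rfl⟩ := huv
      rw [List.cons_append, cons_mem_graftVerts] at hv
      obtain ⟨i, hi, hv⟩ := hv
      rw [cons_mem_graftVerts]
      exact ⟨i, hi, (G i).prefix_closed _ _ ⟨t, rfl⟩ hv⟩
  labels_pos := by
    intro u hu i hi
    cases u with
    | nil => simp at hi
    | cons a u =>
      rw [cons_mem_graftVerts] at hu
      obtain ⟨j, hj, hv⟩ := hu
      rcases List.mem_cons.1 hi with h | h
      · omega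
      · exact (G j).labels_pos _ hv _ h
  children_closed := by
    intro u i hi hu
    cases u with
    | nil =>
      simp only [List.nil_append] at hu ⊢
      rw [cons_mem_graftVerts] at hu ⊢
      obtain ⟨j, hj, hv⟩ := hu
      exact ⟨⟨i - 1, by omega⟩, by simp; omega, root_mem _⟩
    | cons a u =>
      rw [List.cons_append, cons_mem_graftVerts] at hu ⊢
      obtain ⟨j, hj, hv⟩ := hu
      exact ⟨j, hj, (G j).children_closed _ _ hi hv⟩

theorem cons_mem_graft {k : ℕ} (G : Fin k → PlaneTree) (i : Fin k) (v : List ℕ) :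
    (i.val + 1) :: v ∈ (graft G).verts ↔ v ∈ (G i).verts := by
  change _ ∈ graftVerts G ↔ _
  rw [cons_mem_graftVerts]
  constructor
  · rintro ⟨j, hj, hv⟩
    have : i = j := by ext; omega
    subst this; exact hv
  · intro h; exact ⟨i, rfl, h⟩

theorem graft_kc_root {k : ℕ} (G : Fin k → PlaneTree) : (graft G).kc [] = k := by
  apply kc_eq_of_iff
  intro i
  change _ ∈ graftVerts G ↔ _
  rw [List.nil_append, cons_mem_graftVerts]
  constructor
  · rintro ⟨j, hj, _⟩; omega
  · rintro ⟨h1, h2⟩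
    exact ⟨⟨i - 1, by omega⟩, by simp; omega, root_mem _⟩

theorem graft_kc_cons {k : ℕ} (G : Fin k → PlaneTree) (i : Fin k) (v : List ℕ) :
    (graft G).kc ((i.val + 1) :: v) = (G i).kc v := by
  simp only [kc, List.cons_append, cons_mem_graft]

theorem graft_subtreeSize {k : ℕ} (G : Fin k → PlaneTree) (i : Fin k) :
    (graft G).subtreeSize [i.val + 1] = (G i).verts.card := by
  have : {v : List ℕ | v ∈ (graft G).verts ∧ [i.val + 1] <+: v} =
      (((G i).verts.image (List.cons (i.val + 1)) : Finset (List ℕ)) : Set (List ℕ)) := by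
    ext v
    simp only [mem_ofPred_eq, Finset.coe_image, mem_image, Finset.mem_coe]
    constructor
    · rintro ⟨h, t, rfl⟩
      exact ⟨t, (cons_mem_graft G i t).1 h, rfl⟩
    · rintro ⟨t, ht, rfl⟩
      exact ⟨(cons_mem_graft G i t).2 ht, t, rfl⟩
  rw [subtreeSize, this, Set.ncard_coe_finset, Finset.card_image_of_injective]
  exact List.cons_injective

theorem graft_erase {k : ℕ} (G : Fin k → PlaneTree) : (graft G).verts.erase [] =
    Finset.univ.biUnion fun i : Fin k => (G i).verts.image (List.cons (i.val + 1)) := by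
  change (graftVerts G).erase [] = _
  rw [graftVerts, Finset.erase_insert]
  simp

theorem graft_disj {k : ℕ} (G : Fin k → PlaneTree) :
    Set.PairwiseDisjoint ((Finset.univ : Finset (Fin k)) : Set (Fin k))
      (fun i : Fin k => (G i).verts.image (List.cons (i.val + 1))) := by
  intro i _ j _ hij
  rw [Function.onFun, Finset.disjoint_left]
  intro v hv hw
  simp only [Finset.mem_image] at hv hw
  obtain ⟨a, _, rfl⟩ := hv
  obtain ⟨b, _, hb⟩ := hw
  simp only [List.cons.injEq] at hb
  apply hij; ext; omega

theorem graft_card {k : ℕ} (G : Fin k → PlaneTree) :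
    (graft G).verts.card = (∑ i, (G i).verts.card) + 1 := by
  rw [← Finset.card_erase_add_one (root_mem _), graft_erase, Finset.card_biUnion]
  · congr 1
    apply Finset.sum_congr rfl
    intro i _
    exact Finset.card_image_of_injective _ List.cons_injective
  · intro i _ j _ hij
    exact graft_disj G (by simp) (by simp) hij

theorem graft_modW (μ0 μ : ℕ → ℝ) {k : ℕ} (G : Fin k → PlaneTree) :
    bgwModW μ0 μ (graft G) = μ0 k * ∏ i, bgwW μ (G i) := by
  rw [bgwModW, graft_kc_root, graft_erase, Finset.prod_biUnion (graft_disj G)]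
  congr 1
  apply Finset.prod_congr rfl
  intro i _
  rw [Finset.prod_image (fun a _ b _ h => List.cons_injective h)]
  simp only [graft_kc_cons, bgwW]

theorem bgwW_eq_modW (μ : ℕ → ℝ) (τ : PlaneTree) : bgwW μ τ = bgwModW μ μ τ := by
  rw [bgwW, bgwModW, Finset.mul_prod_erase τ.verts (fun u => μ (τ.kc u)) τ.root_mem]

theorem graft_injective (k : ℕ) : Function.Injective (graft (k := k)) := by
  intro G H h
  funext i
  apply ext_verts
  ext v
  rw [← cons_mem_graft G, h, cons_mem_graft]

/-- The subtree grafted on the child `i` of the root. -/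
def sub (τ : PlaneTree) (i : ℕ) (h : [i] ∈ τ.verts) : PlaneTree where
  verts := τ.verts.preimage (List.cons i) List.cons_injective.injOn
  root_mem := by simpa using h
  prefix_closed := by
    intro u v huv hv
    simp only [Finset.mem_preimage] at hv ⊢
    obtain ⟨t, rfl⟩ := huv
    exact τ.prefix_closed _ _ ⟨t, rfl⟩ hv
  labels_pos := by
    intro u hu j hj
    simp only [Finset.mem_preimage] at hu
    exact τ.labels_pos _ hu j (by simp [hj])
  children_closed := by
    intro u j hj hu
    simp only [Finset.mem_preimage] at hu ⊢
    exact τ.children_closed (i :: u) j hj hu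

theorem graft_surj (τ : PlaneTree) : ∃ G : Fin (τ.kc []) → PlaneTree, graft G = τ := by
  have hm : ∀ i : ℕ, [i] ∈ τ.verts ↔ 1 ≤ i ∧ i ≤ τ.kc [] := fun i => by
    simpa using τ.mem_child_iff [] i
  refine ⟨fun i => τ.sub (i.val + 1) ((hm _).2 ⟨by omega, by omega⟩), ?_⟩
  apply ext_verts
  ext v
  cases v with
  | nil => simp [root_mem]
  | cons a v =>
    change _ ∈ graftVerts _ ↔ _
    rw [cons_mem_graftVerts]
    constructor
    · rintro ⟨i, rfl, hv⟩
      simpa [sub] using hv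
    · intro h
      have h1 := (hm a).1 (τ.prefix_closed _ _ ⟨v, rfl⟩ h)
      refine ⟨⟨a - 1, by omega⟩, by simp; omega, ?_⟩
      have : a - 1 + 1 = a := by omega
      simpa [sub, this] using h

theorem graft_bijOn (k n : ℕ) : Set.BijOn (graft (k := k))
    {G | ∑ i, (G i).verts.card = n} {τ | τ.verts.card = n + 1 ∧ τ.kc [] = k} := by
  refine ⟨?_, (graft_injective k).injOn, ?_⟩
  · intro G hG
    simp only [mem_ofPred_eq] at hG ⊢
    rw [graft_card, hG, graft_kc_root]; simp
  · rintro τ ⟨h1, rfl⟩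
    obtain ⟨G, hG⟩ := τ.graft_surj
    refine ⟨G, ?_, hG⟩
    have := graft_card G
    rw [hG, h1] at this
    simp only [mem_ofPred_eq]; omega

theorem card_pos (τ : PlaneTree) : 1 ≤ τ.verts.card := Finset.card_pos.2 ⟨_, τ.root_mem⟩

theorem le_forest_card {k : ℕ} (G : Fin k → PlaneTree) : k ≤ ∑ i, (G i).verts.card := by
  have : ∑ i : Fin k, 1 ≤ ∑ i, (G i).verts.card := Finset.sum_le_sum fun i _ => (G i).card_pos
  simpa using this

theorem finite_card_lt (n : ℕ) : {τ : PlaneTree | τ.verts.card < n}.Finite := by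
  induction n with
  | zero => simp
  | succ n ih =>
    have : {τ : PlaneTree | τ.verts.card < n + 1} ⊆
        ⋃ k ∈ Finset.range n, graft (k := k) '' (Set.pi Set.univ fun _ => {τ : PlaneTree | τ.verts.card < n}) := by
      intro τ hτ
      obtain ⟨G, hG⟩ := τ.graft_surj
      have hc := graft_card G
      have hl := le_forest_card G
      simp only [mem_ofPred_eq] at hτ
      rw [hG] at hc
      simp only [mem_iUnion]
      refine ⟨τ.kc [], by simp; omega, G, ?_, hG⟩
      intro i _
      have := Finset.single_le_sum (f := fun i => (G i).verts.card) (fun _ _ => Nat.zero_le _)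
        (Finset.mem_univ i)
      simp only [mem_ofPred_eq] at this ⊢
      omega
    refine Set.Finite.subset ?_ this
    refine Set.Finite.biUnion (Finset.finite_toSet _) fun k _ => ?_
    exact (Set.Finite.pi fun _ => ih).image _

theorem finite_card (n : ℕ) : {τ : PlaneTree | τ.verts.card = n}.Finite :=
  (finite_card_lt (n + 1)).subset fun τ h => by simp only [mem_ofPred_eq] at h ⊢; omega

theorem finite_forest (j m : ℕ) : {G : Fin j → PlaneTree | ∑ i, (G i).verts.card = m}.Finite := by
  refine Set.Finite.subset (Set.Finite.pi fun _ : Fin j => finite_card_lt (m + 1)) ?_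
  intro G hG i _
  have := Finset.single_le_sum (f := fun i => (G i).verts.card) (fun _ _ => Nat.zero_le _)
    (Finset.mem_univ i)
  simp only [mem_ofPred_eq] at this hG ⊢
  omega

end PlaneTree

open PlaneTree

/-- Mass of trees with `m` vertices. -/
def treeSum (μ : ℕ → ℝ) (m : ℕ) : ℝ := ∑ᶠ τ ∈ {τ : PlaneTree | τ.verts.card = m}, bgwW μ τ

/-- Mass of forests of `j` trees with `m` vertices in total. -/
def forestSum (μ : ℕ → ℝ) (j m : ℕ) : ℝ :=
  ∑ᶠ G ∈ {G : Fin j → PlaneTree | (∑ i, (G i).verts.card) = m}, ∏ i, bgwW μ (G i)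

theorem treeSum_zero (μ : ℕ → ℝ) : treeSum μ 0 = 0 := by
  have : {τ : PlaneTree | τ.verts.card = 0} = ∅ := by
    ext τ; have := τ.card_pos; simp only [mem_ofPred_eq, mem_empty_iff_false, iff_false]; omega
  rw [treeSum, this, finsum_mem_empty]

theorem forestSum_of_lt (μ : ℕ → ℝ) (j m : ℕ) (h : m < j) : forestSum μ j m = 0 := by
  have : {G : Fin j → PlaneTree | (∑ i, (G i).verts.card) = m} = ∅ := by
    ext G; have := le_forest_card G
    simp only [mem_ofPred_eq, mem_empty_iff_false, iff_false]; omega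
  rw [forestSum, this, finsum_mem_empty]

theorem forestSum_zero (μ : ℕ → ℝ) (m : ℕ) : forestSum μ 0 m = if m = 0 then 1 else 0 := by
  rw [forestSum]
  split_ifs with h
  · subst h
    have : {G : Fin 0 → PlaneTree | (∑ i, (G i).verts.card) = 0} = {Fin.elim0} := by
      ext G
      simp only [mem_ofPred_eq, mem_singleton_iff]
      constructor
      · intro _; funext i; exact i.elim0
      · intro _; simp
    rw [this, finsum_mem_singleton]
    simp
  · have : {G : Fin 0 → PlaneTree | (∑ i, (G i).verts.card) = m} = ∅ := by
      ext G
      simp only [mem_ofPred_eq, mem_empty_iff_false, iff_false]; simp; omega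
    rw [this, finsum_mem_empty]

/-- Summation over forests of `j+1` trees in which tree `i` has size `a`
and the others have total size `b`. -/
theorem forest_insertNth (μ : ℕ → ℝ) (j a b : ℕ) (i : Fin (j + 1)) :
    ∑ᶠ G ∈ {G : Fin (j + 1) → PlaneTree | (G i).verts.card = a ∧
      ∑ l, (G (i.succAbove l)).verts.card = b}, ∏ l, bgwW μ (G l)
      = treeSum μ a * forestSum μ j b := by
  rw [treeSum, forestSum]
  rw [finsum_mem_eq_finite_toFinset_sum _ (finite_card a),
    finsum_mem_eq_finite_toFinset_sum _ (finite_forest j b), Finset.sum_mul_sum,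
    ← Finset.sum_product']
  have hb : Set.BijOn (fun p : PlaneTree × (Fin j → PlaneTree) => Fin.insertNth (α := fun _ => PlaneTree) i p.1 p.2)
      (((finite_card a).toFinset ×ˢ (finite_forest j b).toFinset : Finset _) : Set _)
      {G : Fin (j + 1) → PlaneTree | (G i).verts.card = a ∧
      ∑ l, (G (i.succAbove l)).verts.card = b} := by
    refine ⟨?_, ?_, ?_⟩
    · rintro ⟨τ, G⟩ h
      simpa using h
    · exact ((Fin.insertNthEquiv (fun _ => PlaneTree) i).injective).injOn
    · rintro G h
      refine ⟨(G i, fun l => G (i.succAbove l)), by simpa using h, ?_⟩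
      exact (Fin.insertNthEquiv (fun _ => PlaneTree) i).right_inv G
  rw [← hb.image_eq, finsum_mem_image hb.injOn, finsum_mem_coe_finset]
  apply Finset.sum_congr rfl
  rintro ⟨τ, G⟩ _
  rw [Fin.prod_univ_succAbove _ i]
  simp

theorem forestSum_succ (μ : ℕ → ℝ) (j m : ℕ) : forestSum μ (j + 1) m =
    ∑ p ∈ Finset.HasAntidiagonal.antidiagonal m, treeSum μ p.1 * forestSum μ j p.2 := by
  simp_rw [← forest_insertNth μ j _ _ 0]
  have hU : {G : Fin (j + 1) → PlaneTree | (∑ i, (G i).verts.card) = m} =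
      ⋃ p ∈ ((Finset.HasAntidiagonal.antidiagonal m : Finset (ℕ × ℕ)) : Set (ℕ × ℕ)), {G : Fin (j + 1) → PlaneTree | (G 0).verts.card = p.1 ∧
      ∑ l : Fin j, (G ((0 : Fin (j+1)).succAbove l)).verts.card = p.2} := by
    ext G
    simp only [mem_ofPred_eq, mem_iUnion, Finset.mem_coe, Finset.HasAntidiagonal.mem_antidiagonal]
    rw [Fin.sum_univ_succAbove _ 0]
    constructor
    · intro h; exact ⟨(_, _), h, rfl, rfl⟩
    · rintro ⟨p, h, h1, h2⟩; rw [h1, h2, h]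
  rw [forestSum, hU, finsum_mem_biUnion _ (Finset.finite_toSet _), finsum_mem_coe_finset]
  · intro p hp
    refine (finite_forest (j+1) m).subset ?_
    rw [hU]; exact Set.subset_biUnion_of_mem (u := fun p : ℕ × ℕ => {G : Fin (j + 1) → PlaneTree | (G 0).verts.card = p.1 ∧
      ∑ l : Fin j, (G ((0 : Fin (j+1)).succAbove l)).verts.card = p.2}) hp
  · intro p _ q _ hpq
    rw [Function.onFun, Set.disjoint_left]
    rintro G ⟨h1, h2⟩ ⟨h3, h4⟩
    exact hpq (Prod.ext (h1.symm.trans h3) (h2.symm.trans h4))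

theorem modW_sum_kc (μ0 μ : ℕ → ℝ) (j n : ℕ) :
    ∑ᶠ τ ∈ {τ : PlaneTree | τ.verts.card = n + 1 ∧ τ.kc [] = j}, bgwModW μ0 μ τ
      = μ0 j * forestSum μ j n := by
  rw [← (graft_bijOn j n).image_eq, finsum_mem_image (graft_bijOn j n).injOn, forestSum,
    mul_finsum_mem]
  simp_rw [graft_modW]

theorem modMass_eq (μ0 μ : ℕ → ℝ) (n : ℕ) : bgwModMass μ0 μ (n + 1) =
    ∑ j ∈ Finset.range (n + 1), μ0 j * forestSum μ j n := by
  simp_rw [← modW_sum_kc]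
  have hU : {τ : PlaneTree | τ.verts.card = n + 1} =
      ⋃ j ∈ ((Finset.range (n + 1) : Finset ℕ) : Set ℕ),
        {τ : PlaneTree | τ.verts.card = n + 1 ∧ τ.kc [] = j} := by
    ext τ
    simp only [mem_ofPred_eq, mem_iUnion, Finset.mem_coe, Finset.mem_range]
    constructor
    · intro h
      obtain ⟨G, hG⟩ := τ.graft_surj
      have := graft_card G
      have := le_forest_card G
      rw [hG] at *
      exact ⟨τ.kc [], by omega, h, rfl⟩
    · rintro ⟨j, _, h, _⟩; exact h
  rw [bgwModMass, hU, finsum_mem_biUnion _ (Finset.finite_toSet _), finsum_mem_coe_finset]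
  · intro j _
    exact (finite_card (n+1)).subset fun τ h => h.1
  · intro p _ q _ hpq
    rw [Function.onFun, Set.disjoint_left]
    rintro G ⟨h1, h2⟩ ⟨h3, h4⟩
    exact hpq (h2.symm.trans h4)

theorem treeSum_succ (μ : ℕ → ℝ) (n : ℕ) : treeSum μ (n + 1) =
    ∑ j ∈ Finset.range (n + 1), μ j * forestSum μ j n := by
  rw [← modMass_eq, bgwModMass, treeSum]
  simp_rw [bgwW_eq_modW]

theorem graft_maxSub {k : ℕ} (G : Fin k → PlaneTree) :
    (graft G).maxSub = Finset.univ.sup fun i => (G i).verts.card := by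
  rw [maxSub, graft_kc_root]
  apply le_antisymm
  · apply Finset.sup_le
    intro i hi
    simp only [Finset.mem_Icc] at hi
    obtain ⟨i', rfl⟩ : ∃ i', i = i' + 1 := ⟨i - 1, by omega⟩
    have := graft_subtreeSize G ⟨i', by omega⟩
    simp only at this
    rw [this]
    exact Finset.le_sup (f := fun i => (G i).verts.card) (Finset.mem_univ _)
  · apply Finset.sup_le
    intro i _
    rw [← graft_subtreeSize]
    exact Finset.le_sup (f := fun i => (graft G).subtreeSize [i]) (by simp)

theorem numerator_eq (μ0 μ : ℕ → ℝ) (k l N : ℕ) (hN : 2 * k < N) :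
    ∑ᶠ τ ∈ {τ : PlaneTree | τ.verts.card = N + 1 ∧ N + 1 - 1 - τ.maxSub = k ∧ τ.kc [] = l + 1},
      bgwModW μ0 μ τ = μ0 (l + 1) * ((l + 1 : ℕ) * (treeSum μ (N - k) * forestSum μ l k)) := by
  have hset : {τ : PlaneTree | τ.verts.card = N + 1 ∧ N + 1 - 1 - τ.maxSub = k ∧ τ.kc [] = l + 1}
      = graft (k := l + 1) '' (⋃ i ∈ ((Finset.univ : Finset (Fin (l + 1))) : Set (Fin (l + 1))),
        {G : Fin (l + 1) → PlaneTree | (G i).verts.card = N - k ∧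
          ∑ m, (G (i.succAbove m)).verts.card = k}) := by
    ext τ
    simp only [mem_ofPred_eq, mem_image, mem_iUnion]
    constructor
    · rintro ⟨h1, h2, h3⟩
      have := (graft_bijOn (l + 1) N).surjOn (show τ ∈ {τ | _} from ⟨h1, h3⟩)
      obtain ⟨G, hG, rfl⟩ := this
      refine ⟨G, ?_, rfl⟩
      simp only [mem_ofPred_eq] at hG
      rw [graft_maxSub] at h2
      obtain ⟨i, -, hi⟩ := Finset.exists_mem_eq_sup Finset.univ Finset.univ_nonempty
        (fun i => (G i).verts.card)
      rw [hi] at h2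
      rw [Fin.sum_univ_succAbove _ i] at hG
      refine ⟨i, by simp, by omega, by omega⟩
    · rintro ⟨G, ⟨i, -, h1, h2⟩, rfl⟩
      refine ⟨?_, ?_, graft_kc_root G⟩
      · rw [graft_card, Fin.sum_univ_succAbove _ i, h1, h2]; omega
      · have : (graft G).maxSub = N - k := by
          rw [graft_maxSub]
          apply le_antisymm
          · apply Finset.sup_le
            intro m _
            rcases Fin.eq_self_or_eq_succAbove i m with rfl | ⟨m', rfl⟩
            · omega
            · have := Finset.single_le_sum (f := fun m => (G (i.succAbove m)).verts.card)
                (fun _ _ => Nat.zero_le _) (Finset.mem_univ m')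
              omega
          · rw [← h1]
            exact Finset.le_sup (f := fun i => (G i).verts.card) (Finset.mem_univ _)
        rw [this]; omega
  rw [hset, finsum_mem_image (graft_injective _).injOn]
  simp_rw [graft_modW]
  rw [finsum_mem_biUnion _ (Finset.finite_toSet _), finsum_mem_coe_finset]
  · have : ∀ i : Fin (l + 1), ∑ᶠ G ∈ {G : Fin (l + 1) → PlaneTree | (G i).verts.card = N - k ∧
          ∑ m, (G (i.succAbove m)).verts.card = k}, μ0 (l + 1) * ∏ m, bgwW μ (G m) =
        μ0 (l + 1) * (treeSum μ (N - k) * forestSum μ l k) := by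
      intro i
      rw [← forest_insertNth μ l (N - k) k i, mul_finsum_mem]
    rw [Finset.sum_congr rfl (fun i _ => this i)]
    simp only [Finset.sum_const, Finset.card_univ, Fintype.card_fin, nsmul_eq_mul]
    ring
  · intro i _
    refine (finite_forest (l+1) N).subset ?_
    rintro G ⟨h1, h2⟩
    simp only [mem_ofPred_eq]
    rw [Fin.sum_univ_succAbove _ i, h1, h2]; omega
  · intro p _ q _ hpq
    rw [Function.onFun, Set.disjoint_left]
    rintro G ⟨h1, h2⟩ ⟨h3, h4⟩
    obtain ⟨q', hq⟩ := Fin.exists_succAbove_eq hpq.symm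
    have := Finset.single_le_sum (f := fun m => (G (p.succAbove m)).verts.card)
                (fun _ _ => Nat.zero_le _) (Finset.mem_univ q')
    simp only [hq] at this
    omega

end

end

section

open Filter Set

noncomputable section

/-- Coefficients of the powers of the generating series of `μ`. -/
def cc (μ : ℕ → ℝ) (N r : ℕ) : ℝ := PowerSeries.coeff r (PowerSeries.mk μ ^ N)

theorem cc_succ (μ : ℕ → ℝ) (N r : ℕ) : cc μ (N + 1) r =
    ∑ p ∈ Finset.HasAntidiagonal.antidiagonal r, μ p.1 * cc μ N p.2 := by
  simp [cc, pow_succ', PowerSeries.coeff_mul]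

theorem forestSum_eq_coeff (μ : ℕ → ℝ) (j m : ℕ) :
    forestSum μ j m = PowerSeries.coeff m (PowerSeries.mk (treeSum μ) ^ j) := by
  induction j generalizing m with
  | zero => simp [forestSum_zero, PowerSeries.coeff_one]
  | succ j ih =>
    rw [forestSum_succ, pow_succ', PowerSeries.coeff_mul]
    simp [ih]

theorem forestSum_add (μ : ℕ → ℝ) (i j m : ℕ) : forestSum μ (i + j) m =
    ∑ p ∈ Finset.HasAntidiagonal.antidiagonal m, forestSum μ i p.1 * forestSum μ j p.2 := by
  simp only [forestSum_eq_coeff, pow_add, PowerSeries.coeff_mul]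

theorem forestSum_rec (μ : ℕ → ℝ) (j m : ℕ) : forestSum μ (j + 1) (m + 1) =
    ∑ k ∈ Finset.range (m + 1), μ k * forestSum μ (k + j) m := by
  rw [forestSum_succ, Finset.Nat.sum_antidiagonal_succ]
  simp only [treeSum_zero, zero_mul, zero_add]
  simp_rw [forestSum_add, Finset.mul_sum]
  rw [Finset.sum_comm]
  apply Finset.sum_congr rfl
  intro p hp
  rw [Finset.HasAntidiagonal.mem_antidiagonal] at hp
  rw [treeSum_succ, Finset.sum_mul]
  rw [← Finset.sum_subset (Finset.range_mono (show p.1 + 1 ≤ m + 1 by omega))]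
  · apply Finset.sum_congr rfl
    intro k _; ring
  · intro k _ hk
    rw [forestSum_of_lt μ k p.1 (by simpa using hk)]; ring

theorem cc_deriv (μ : ℕ → ℝ) (N r : ℕ) :
    ((N : ℝ) + 1) * ∑ p ∈ Finset.HasAntidiagonal.antidiagonal r, (p.1 : ℝ) * μ p.1 * cc μ N p.2
      = r * cc μ (N + 1) r := by
  cases r with
  | zero => simp
  | succ r =>
    rw [Finset.Nat.sum_antidiagonal_succ]
    have h := congrArg (PowerSeries.coeff r)
      (Derivation.leibniz_pow (PowerSeries.derivative ℝ) (a := PowerSeries.mk μ) (N + 1))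
    rw [PowerSeries.coeff_derivative] at h
    simp only [Nat.add_sub_cancel, smul_eq_mul, nsmul_eq_mul] at h
    rw [mul_comm (PowerSeries.mk μ ^ N)] at h
    have h2 : ((N + 1 : ℕ) : PowerSeries ℝ) = PowerSeries.C ((N + 1 : ℕ) : ℝ) := by simp
    rw [h2, PowerSeries.coeff_C_mul, PowerSeries.coeff_mul] at h
    simp only [PowerSeries.coeff_derivative, PowerSeries.coeff_mk] at h
    simp only [cc]
    push_cast at h ⊢
    rw [mul_comm ((r : ℝ) + 1), h]
    simp only [zero_mul, zero_add]
    congr 1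
    apply Finset.sum_congr rfl
    intro p _; ring

theorem lagrange (μ : ℕ → ℝ) (m j : ℕ) (hj : j ≤ m) :
    (m : ℝ) * forestSum μ j m = j * cc μ m (m - j) := by
  induction m generalizing j with
  | zero => 
    have : j = 0 := by omega
    subst this; simp
  | succ N ih =>
    cases j with
    | zero => simp [forestSum_zero]
    | succ j =>
      rcases Nat.eq_zero_or_pos N with rfl | hN
      · have : j = 0 := by omega
        subst this
        rw [forestSum_rec]
        simp [forestSum_zero, cc]
      have hN' : (N : ℝ) ≠ 0 := by positivity
      obtain ⟨r, rfl⟩ : ∃ r, N = j + r := ⟨N - j, by omega⟩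
      have e : j + r + 1 - (j + 1) = r := by omega
      rw [e]
      have h1 : ((j + r : ℕ) : ℝ) * forestSum μ (j + 1) (j + r + 1) =
          ∑ p ∈ Finset.HasAntidiagonal.antidiagonal r, μ p.1 * ((j + p.1) * cc μ (j + r) p.2) := by
        rw [forestSum_rec, Finset.mul_sum]
        rw [Finset.Nat.sum_antidiagonal_eq_sum_range_succ
          (fun k q => μ k * ((j + k) * cc μ (j + r) q))]
        symm
        have hs := Finset.sum_subset (f := fun k => ((j + r : ℕ) : ℝ) * (μ k * forestSum μ (k + j) (j + r)))
          (Finset.range_mono (show r + 1 ≤ j + r + 1 by omega))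
          (by
            intro k _ hk
            rw [forestSum_of_lt μ _ _ (by simp at hk; omega)]; ring)
        rw [← hs]
        apply Finset.sum_congr rfl
        intro k hk
        simp only [Finset.mem_range] at hk
        have := ih (k + j) (by omega)
        have e2 : j + r - (k + j) = r - k := by omega
        rw [e2] at this
        push_cast at this ⊢
        linear_combination (- μ k) * this
      have h2 := cc_succ μ (j + r) r
      have h3 := cc_deriv μ (j + r) r
      have h4 : ∑ p ∈ Finset.HasAntidiagonal.antidiagonal r, μ p.1 * ((j + p.1) * cc μ (j + r) p.2)
          = j * cc μ (j + r + 1) r + ∑ p ∈ Finset.HasAntidiagonal.antidiagonal r,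
            (p.1 : ℝ) * μ p.1 * cc μ (j + r) p.2 := by
        rw [h2, Finset.mul_sum, ← Finset.sum_add_distrib]
        apply Finset.sum_congr rfl
        intro p _; ring
      rw [h4] at h1
      apply mul_left_cancel₀ hN'
      push_cast at h1 h3 ⊢
      linear_combination ((j:ℝ) + r + 1) * h1 + h3

end

end

section

open Filter Set

noncomputable section

open MeasureTheory in
/-- The characteristic function of `μ`. -/
def FF (μ : ℕ → ℝ) (s : ℝ) : ℂ := ∑' k : ℕ, (μ k : ℂ) * Complex.exp ((s * k : ℝ) * Complex.I)

theorem norm_FF_term (μ : ℕ → ℝ) (hnn : ∀ j, 0 ≤ μ j) (s : ℝ) (k : ℕ) :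
    ‖(μ k : ℂ) * Complex.exp ((s * k : ℝ) * Complex.I)‖ = μ k := by
  rw [norm_mul, Complex.norm_exp_ofReal_mul_I, mul_one, Complex.norm_real, Real.norm_of_nonneg (hnn k)]

theorem summable_FF (μ : ℕ → ℝ) (hnn : ∀ j, 0 ≤ μ j) (hs : HasSum μ 1) (s : ℝ) :
    Summable fun k : ℕ => ‖(μ k : ℂ) * Complex.exp ((s * k : ℝ) * Complex.I)‖ := by
  simp_rw [norm_FF_term μ hnn]; exact hs.summable

theorem hasSum_FF (μ : ℕ → ℝ) (hnn : ∀ j, 0 ≤ μ j) (hs : HasSum μ 1) (s : ℝ) :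
    HasSum (fun k : ℕ => (μ k : ℂ) * Complex.exp ((s * k : ℝ) * Complex.I)) (FF μ s) :=
  (summable_FF μ hnn hs s).of_norm.hasSum

theorem continuous_FF (μ : ℕ → ℝ) (hnn : ∀ j, 0 ≤ μ j) (hs : HasSum μ 1) :
    Continuous (FF μ) := by
  refine continuous_tsum (u := μ) (fun k => by fun_prop) hs.summable ?_
  intro k s
  rw [norm_FF_term μ hnn]

theorem norm_FF_le_one (μ : ℕ → ℝ) (hnn : ∀ j, 0 ≤ μ j) (hs : HasSum μ 1) (s : ℝ) :
    ‖FF μ s‖ ≤ 1 := by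
  have := norm_tsum_le_tsum_norm (summable_FF μ hnn hs s)
  simp_rw [norm_FF_term μ hnn] at this
  rw [hs.tsum_eq] at this
  exact this

/-- `1 - Re F`. -/
theorem hasSum_re (μ : ℕ → ℝ) (hnn : ∀ j, 0 ≤ μ j) (hs : HasSum μ 1) (s : ℝ) :
    HasSum (fun k : ℕ => μ k * (1 - Real.cos (s * k))) (1 - (FF μ s).re) := by
  have h := Complex.hasSum_re (hasSum_FF μ hnn hs s)
  have h2 := hs.sub h
  have e : (fun k : ℕ => μ k * (1 - Real.cos (s * k))) = fun k =>
      μ k - ((μ k : ℂ) * Complex.exp ((s * k : ℝ) * Complex.I)).re := by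
    funext k
    rw [Complex.re_ofReal_mul, Complex.exp_ofReal_mul_I_re]
    ring
  rw [e]
  exact h2

theorem norm_FF_le (μ : ℕ → ℝ) (hnn : ∀ j, 0 ≤ μ j) (hs : HasSum μ 1) (s : ℝ) :
    ‖FF μ s‖ ≤ 1 - μ 0 * (1 - (FF μ s).re) := by
  set F := FF μ s with hF
  have h01 : μ 0 ≤ 1 := le_hasSum hs 0 (fun j _ => hnn j)
  have h00 := hnn 0
  have hre : F.re ≤ 1 := (Complex.re_le_norm F).trans (norm_FF_le_one μ hnn hs s)
  have hre' : -1 ≤ F.re := by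
    have := (Complex.abs_re_le_norm F).trans (norm_FF_le_one μ hnn hs s)
    exact (abs_le.1 this).1
  -- distance to μ 0
  have hd : ‖F - μ 0‖ ≤ 1 - μ 0 := by
    have hsum := summable_FF μ hnn hs s
    have e : F - μ 0 = ∑' k : ℕ, (μ (k + 1) : ℂ) * Complex.exp ((s * (k + 1 : ℕ) : ℝ) * Complex.I) := by
      rw [hF, FF, hsum.of_norm.tsum_eq_zero_add]
      simp
    rw [e]
    have hsum' := (summable_nat_add_iff (f := fun k : ℕ => ‖(μ k : ℂ) * Complex.exp ((s * k : ℝ) * Complex.I)‖) 1).2 hsum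
    refine (norm_tsum_le_tsum_norm hsum').trans ?_
    simp_rw [norm_FF_term μ hnn]
    have := hs.summable.tsum_eq_zero_add
    rw [hs.tsum_eq] at this
    linarith
  have hd2 : ‖F - μ 0‖ ^ 2 ≤ (1 - μ 0) ^ 2 := by gcongr
  rw [← Complex.normSq_eq_norm_sq, Complex.normSq_apply] at hd2
  simp only [Complex.sub_re, Complex.ofReal_re, Complex.sub_im, Complex.ofReal_im, sub_zero] at hd2
  have hp : 0 ≤ 1 - μ 0 * (1 - F.re) := by
    have h1 : F.re * F.re + F.im * F.im ≤ 1 := by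
      have := norm_FF_le_one μ hnn hs s
      have h : ‖F‖ ^ 2 ≤ 1 := by rw [← one_pow 2]; gcongr
      rwa [← Complex.normSq_eq_norm_sq, Complex.normSq_apply] at h
    by_contra hc
    push Not at hc
    nlinarith [sq_nonneg (F.im), sq_nonneg (1 - F.re)]
  apply (sq_le_sq₀ (norm_nonneg F) hp).1
  rw [← Complex.normSq_eq_norm_sq, Complex.normSq_apply]
  nlinarith [sq_nonneg (μ 0 * (1 - F.re))]

theorem cc_nonneg (μ : ℕ → ℝ) (hnn : ∀ j, 0 ≤ μ j) (N r : ℕ) : 0 ≤ cc μ N r := by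
  induction N generalizing r with
  | zero => simp only [cc, pow_zero, PowerSeries.coeff_one]; split_ifs <;> norm_num
  | succ N ih =>
    rw [cc_succ]
    exact Finset.sum_nonneg fun p _ => mul_nonneg (hnn _) (ih _)

theorem hasSum_cc_exp (μ : ℕ → ℝ) (hnn : ∀ j, 0 ≤ μ j) (hs : HasSum μ 1) (N : ℕ) (s : ℝ) :
    (Summable fun r : ℕ => cc μ N r) ∧
    HasSum (fun r : ℕ => (cc μ N r : ℂ) * Complex.exp ((s * r : ℝ) * Complex.I)) (FF μ s ^ N) := by
  have key : ∀ N, (Summable fun r : ℕ => ‖(cc μ N r : ℂ) * Complex.exp ((s * r : ℝ) * Complex.I)‖) ∧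
    HasSum (fun r : ℕ => (cc μ N r : ℂ) * Complex.exp ((s * r : ℝ) * Complex.I)) (FF μ s ^ N) := by
    intro N
    induction N with
    | zero =>
      have e : (fun r : ℕ => (cc μ 0 r : ℂ) * Complex.exp ((s * r : ℝ) * Complex.I)) =
          fun r => if r = 0 then 1 else 0 := by
        funext r
        simp only [cc, pow_zero, PowerSeries.coeff_one]
        split_ifs with h
        · simp [h]
        · simp
      have e2 : (fun r : ℕ => ‖(cc μ 0 r : ℂ) * Complex.exp ((s * r : ℝ) * Complex.I)‖) =
          fun r => if r = 0 then 1 else 0 := by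
        funext r
        rw [congrFun e r]; split_ifs <;> simp
      rw [e, e2, pow_zero]
      exact ⟨(hasSum_ite_eq 0 1).summable, hasSum_ite_eq 0 1⟩
    | succ N ih =>
      have e : (fun r : ℕ => (cc μ (N + 1) r : ℂ) * Complex.exp ((s * r : ℝ) * Complex.I)) =
          fun r => ∑ p ∈ Finset.HasAntidiagonal.antidiagonal r,
            ((μ p.1 : ℂ) * Complex.exp ((s * p.1 : ℝ) * Complex.I)) *
            ((cc μ N p.2 : ℂ) * Complex.exp ((s * p.2 : ℝ) * Complex.I)) := by
        funext r
        rw [cc_succ, Complex.ofReal_sum, Finset.sum_mul]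
        apply Finset.sum_congr rfl
        intro p hp
        rw [Finset.HasAntidiagonal.mem_antidiagonal] at hp
        have : Complex.exp ((s * r : ℝ) * Complex.I) = Complex.exp ((s * p.1 : ℝ) * Complex.I) *
            Complex.exp ((s * p.2 : ℝ) * Complex.I) := by
          rw [← Complex.exp_add, ← hp]; congr 1; push_cast; ring
        rw [this]; push_cast; ring
      have hsF := summable_FF μ hnn hs s
      have h1 := summable_norm_sum_mul_antidiagonal_of_summable_norm hsF ih.1
      have h2 := tsum_mul_tsum_eq_tsum_sum_antidiagonal_of_summable_norm hsF ih.1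
      constructor
      · simp_rw [congrFun e]; exact h1
      · rw [e, pow_succ', ← ih.2.tsum_eq, FF, h2]
        exact h1.of_norm.hasSum
  refine ⟨?_, (key N).2⟩
  have := (key N).1
  simp_rw [norm_FF_term (cc μ N) (cc_nonneg μ hnn N)] at this
  exact this

theorem integral_cos_int (m : ℤ) : ∫ s in (0:ℝ)..Real.pi, Real.cos (m * s) =
    if m = 0 then Real.pi else 0 := by
  split_ifs with h
  · simp [h]
  · have hm : (m : ℝ) ≠ 0 := by exact_mod_cast h
    rw [intervalIntegral.integral_comp_mul_left (fun x => Real.cos x) hm, integral_cos]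
    simp [Real.sin_int_mul_pi]

theorem cc_fourier (μ : ℕ → ℝ) (hnn : ∀ j, 0 ≤ μ j) (hs : HasSum μ 1) (N r : ℕ) :
    Real.pi * cc μ N r =
      ∫ s in (0:ℝ)..Real.pi, (FF μ s ^ N * Complex.exp (-((s * r : ℝ) * Complex.I))).re := by
  have hsumm := (hasSum_cc_exp μ hnn hs N 0).1
  have h := intervalIntegral.hasSum_integral_of_dominated_convergence (μ := MeasureTheory.volume)
    (a := (0:ℝ)) (b := Real.pi)
    (F := fun (q : ℕ) (s : ℝ) => cc μ N q * Real.cos (((q : ℤ) - (r : ℤ) : ℤ) * s))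
    (f := fun s => (FF μ s ^ N * Complex.exp (-((s * r : ℝ) * Complex.I))).re)
    (fun q _ => cc μ N q) ?_ ?_ ?_ ?_ ?_
  · have h2 : HasSum (fun q : ℕ => ∫ s in (0:ℝ)..Real.pi, cc μ N q * Real.cos (((q : ℤ) - (r : ℤ) : ℤ) * s))
        (Real.pi * cc μ N r) := by
      have e : (fun q : ℕ => ∫ s in (0:ℝ)..Real.pi, cc μ N q * Real.cos (((q : ℤ) - (r : ℤ) : ℤ) * s))
          = fun q => if q = r then Real.pi * cc μ N r else 0 := by
        funext q
        rw [intervalIntegral.integral_const_mul, integral_cos_int]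
        by_cases hq : q = r
        · simp [hq, mul_comm]
        · have : (q : ℤ) - r ≠ 0 := by omega
          simp [hq, this]
      rw [e]; exact hasSum_ite_eq r _
    exact h2.unique h
  · intro q
    exact Continuous.aestronglyMeasurable (by fun_prop)
  · intro q
    refine Eventually.of_forall fun s _ => ?_
    rw [norm_mul, Real.norm_of_nonneg (cc_nonneg μ hnn N q)]
    exact mul_le_of_le_one_right (cc_nonneg μ hnn N q) (Real.abs_cos_le_one _)
  · exact Eventually.of_forall fun s _ => hsumm
  · simp
  · refine Eventually.of_forall fun s _ => ?_
    have h := Complex.hasSum_re ((hasSum_cc_exp μ hnn hs N s).2.mul_right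
      (Complex.exp (-((s * r : ℝ) * Complex.I))))
    refine h.congr_fun fun q => ?_
    rw [mul_assoc, ← Complex.exp_add, Complex.re_ofReal_mul]
    congr 1
    have : ((s * q : ℝ) * Complex.I + -((s * r : ℝ) * Complex.I) : ℂ) =
      (((((q : ℤ) - (r : ℤ) : ℤ) : ℝ) * s : ℝ) : ℂ) * Complex.I := by push_cast; ring
    rw [this, Complex.exp_ofReal_mul_I_re]

end

end

section

open Filter Set

noncomputable section

open MeasureTheory

theorem J_integrable (α : ℝ) (hα : 1 < α) (b : ℝ) (hb : 0 < b) (e : ℝ) (he : 0 ≤ e) :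
    Integrable (fun t : ℝ => t ^ e * Real.exp (-b * t ^ α)) (volume.restrict (Ioi 0)) :=
  integrableOn_rpow_mul_exp_neg_mul_rpow (by linarith) (by linarith) hb

theorem J_norm (κ : ℂ) (x : ℝ) : ‖Complex.exp (-κ * (x : ℂ))‖ = Real.exp (-κ.re * x) := by
  rw [Complex.norm_exp]; simp

theorem J_cont (α : ℝ) (hα : 1 < α) (κ : ℂ) :
    Continuous (fun t : ℝ => Complex.exp (-κ * ((t ^ α : ℝ) : ℂ))) := by
  have : Continuous fun t : ℝ => t ^ α := Real.continuous_rpow_const (by linarith)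
  fun_prop

theorem J_integrable' (α : ℝ) (hα : 1 < α) (κ : ℂ) (hκ : 0 < κ.re) :
    Integrable (fun t : ℝ => Complex.exp (-κ * ((t ^ α : ℝ) : ℂ))) (volume.restrict (Ioi 0)) := by
  refine Integrable.mono' (J_integrable α hα κ.re hκ 0 le_rfl) (J_cont α hα κ).aestronglyMeasurable ?_
  refine Eventually.of_forall fun t => ?_
  rw [J_norm]; simp

theorem J_integrable'' (α : ℝ) (hα : 1 < α) (κ : ℂ) (hκ : 0 < κ.re) :
    Integrable (fun t : ℝ => ((t ^ α : ℝ) : ℂ) * Complex.exp (-κ * ((t ^ α : ℝ) : ℂ)))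
      (volume.restrict (Ioi 0)) := by
  have hc : Continuous fun t : ℝ => t ^ α := Real.continuous_rpow_const (by linarith)
  refine Integrable.mono' (J_integrable α hα κ.re hκ α (by linarith))
    ((Complex.continuous_ofReal.comp hc).mul (J_cont α hα κ)).aestronglyMeasurable ?_
  filter_upwards [ae_restrict_mem measurableSet_Ioi] with t ht
  rw [norm_mul, J_norm, Complex.norm_real, Real.norm_of_nonneg (Real.rpow_nonneg (le_of_lt ht) _)]

theorem J_parts (α : ℝ) (hα : 1 < α) (κ : ℂ) (hκ : 0 < κ.re) :
    ∫ t in Ioi (0:ℝ), Complex.exp (-κ * ((t ^ α : ℝ) : ℂ)) =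
      α * κ * ∫ t in Ioi (0:ℝ), ((t ^ α : ℝ) : ℂ) * Complex.exp (-κ * ((t ^ α : ℝ) : ℂ)) := by
  have h := integral_Ioi_of_hasDerivAt_of_tendsto (a := (0:ℝ)) (m := (0:ℂ))
    (f := fun t : ℝ => (t : ℂ) * Complex.exp (-κ * ((t ^ α : ℝ) : ℂ)))
    (f' := fun t : ℝ => Complex.exp (-κ * ((t ^ α : ℝ) : ℂ)) -
      α * κ * (((t ^ α : ℝ) : ℂ) * Complex.exp (-κ * ((t ^ α : ℝ) : ℂ)))) ?_ ?_ ?_ ?_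
  · rw [integral_sub (J_integrable' α hα κ hκ) ((J_integrable'' α hα κ hκ).const_mul _),
      integral_const_mul] at h
    simp only [Complex.ofReal_zero, zero_mul, sub_zero] at h
    exact sub_eq_zero.1 h
  · exact (Complex.continuous_ofReal.mul (J_cont α hα κ)).continuousWithinAt
  · intro t ht
    have ht0 : (0:ℝ) < t := ht
    have h1 : HasDerivAt (fun t : ℝ => ((t ^ α : ℝ) : ℂ)) ((α * t ^ (α - 1) : ℝ) : ℂ) t :=
      (Real.hasDerivAt_rpow_const (Or.inr hα.le)).ofReal_comp
    have h2 := (HasDerivAt.ofReal_comp (hasDerivAt_id t)).mul ((h1.const_mul (-κ)).cexp)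
    refine HasDerivAt.congr_deriv h2 ?_
    have : t ^ α = t * t ^ (α - 1) := by
      rw [Real.rpow_sub_one ht0.ne']; field_simp
    rw [show ((t ^ α : ℝ) : ℂ) = t * ((t ^ (α - 1) : ℝ) : ℂ) by rw [this]; push_cast; ring]
    simp only [id]
    push_cast
    ring
  · exact (J_integrable' α hα κ hκ).sub ((J_integrable'' α hα κ hκ).const_mul _)
  · rw [tendsto_zero_iff_norm_tendsto_zero]
    refine squeeze_zero' (Eventually.of_forall fun _ => norm_nonneg _)
      (g := fun t : ℝ => t ^ (1:ℝ) * Real.exp (-κ.re * t)) ?_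
      (tendsto_rpow_mul_exp_neg_mul_atTop_nhds_zero 1 κ.re hκ)
    filter_upwards [eventually_ge_atTop 1] with t ht
    rw [norm_mul, J_norm, Complex.norm_real, Real.norm_of_nonneg (by linarith), Real.rpow_one]
    have : t ≤ t ^ α := by
      conv_lhs => rw [← Real.rpow_one t]
      exact Real.rpow_le_rpow_of_exponent_le ht hα.le
    gcongr ?_ * Real.exp ?_
    nlinarith

theorem J_deriv (α : ℝ) (hα : 1 < α) (κ : ℂ) (hκ : 0 < κ.re) :
    HasDerivAt (fun κ : ℂ => ∫ t in Ioi (0:ℝ), Complex.exp (-κ * ((t ^ α : ℝ) : ℂ)))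
      (∫ t in Ioi (0:ℝ), -(((t ^ α : ℝ) : ℂ) * Complex.exp (-κ * ((t ^ α : ℝ) : ℂ)))) κ := by
  refine (hasDerivAt_integral_of_dominated_loc_of_deriv_le
    (bound := fun t => t ^ α * Real.exp (-(κ.re / 2) * t ^ α))
    (F' := fun κ t => -(((t ^ α : ℝ) : ℂ) * Complex.exp (-κ * ((t ^ α : ℝ) : ℂ))))
    (s := {z : ℂ | κ.re / 2 < z.re}) ?_ ?_ ?_ ?_ ?_ ?_ ?_).2
  · exact (isOpen_lt continuous_const Complex.continuous_re).mem_nhds (by simp only [mem_ofPred_eq]; linarith)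
  · exact Eventually.of_forall fun z => (J_cont α hα z).aestronglyMeasurable
  · exact J_integrable' α hα κ hκ
  · exact (J_integrable'' α hα κ hκ).neg.aestronglyMeasurable
  · filter_upwards [ae_restrict_mem measurableSet_Ioi] with t ht z hz
    have ht0 : 0 ≤ t ^ α := Real.rpow_nonneg (le_of_lt ht) _
    replace hz : κ.re / 2 < z.re := hz
    rw [norm_neg, norm_mul, J_norm, Complex.norm_real, Real.norm_of_nonneg ht0]
    gcongr
  · exact J_integrable α hα _ (by linarith) α (by linarith)
  · refine Eventually.of_forall fun t z _ => ?_
    have h := ((hasDerivAt_id z).neg.mul_const ((t ^ α : ℝ) : ℂ)).cexp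
    refine HasDerivAt.congr_deriv h ?_
    simp only [id, Pi.neg_apply]
    ring

theorem J_pos (α : ℝ) (hα : 1 < α) (κ : ℂ) (hκ : 0 < κ.re) :
    0 < (∫ t in Ioi (0:ℝ), Complex.exp (-κ * ((t ^ α : ℝ) : ℂ))).re := by
  set J : ℂ → ℂ := fun κ => ∫ t in Ioi (0:ℝ), Complex.exp (-κ * ((t ^ α : ℝ) : ℂ)) with hJ
  have hα0 : α ≠ 0 := by linarith
  have hopen : IsOpen {z : ℂ | 0 < z.re} := isOpen_lt continuous_const Complex.continuous_re
  have hder : ∀ z ∈ {z : ℂ | 0 < z.re}, HasDerivAt (fun z : ℂ => z ^ ((1 / α : ℝ) : ℂ) * J z) 0 z := by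
    intro z hz
    simp only [mem_ofPred_eq] at hz
    have hz0 : z ≠ 0 := by rintro rfl; simp at hz
    have h1 : HasDerivAt (fun z : ℂ => z ^ ((1 / α : ℝ) : ℂ)) _ z :=
      (hasDerivAt_id z).cpow_const (Or.inl hz)
    refine (h1.mul (J_deriv α hα z hz)).congr_deriv ?_
    have hp := J_parts α hα z hz
    rw [hp, integral_neg]
    have : (id z) ^ (((1 / α : ℝ) : ℂ) - 1) = z ^ ((1 / α : ℝ) : ℂ) / z := by
      rw [id, Complex.cpow_sub _ _ hz0, Complex.cpow_one]
    rw [this]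
    have hαc : (α : ℂ) ≠ 0 := by exact_mod_cast hα0
    push_cast
    field_simp
    ring
  have hconst : κ ^ ((1 / α : ℝ) : ℂ) * J κ = 1 ^ ((1 / α : ℝ) : ℂ) * J 1 := by
    refine hopen.is_const_of_deriv_eq_zero (convex_halfSpace_re_gt 0).isPreconnected
      (f := fun z : ℂ => z ^ ((1 / α : ℝ) : ℂ) * J z) ?_ ?_ hκ (by simp)
    · intro z hz; exact (hder z hz).differentiableAt.differentiableWithinAt
    · intro z hz; exact (hder z hz).deriv
  rw [Complex.one_cpow, one_mul] at hconst
  have hκ0 : κ ≠ 0 := by rintro rfl; simp at hκ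
  have hJ1 : J 1 = ((∫ t in Ioi (0:ℝ), Real.exp (-(t ^ α)) : ℝ) : ℂ) := by
    have e : ∀ t : ℝ, Complex.exp (-1 * ((t ^ α : ℝ) : ℂ)) = ((Real.exp (-(t ^ α)) : ℝ) : ℂ) := by
      intro t; push_cast; ring_nf
    simp only [hJ, e]
    exact integral_ofReal
  have hpos : 0 < ∫ t in Ioi (0:ℝ), Real.exp (-(t ^ α)) := by
    have hi := J_integrable α hα 1 one_pos 0 le_rfl
    simp only [Real.rpow_zero, one_mul, neg_mul] at hi
    rw [integral_pos_iff_support_of_nonneg (fun t => (Real.exp_pos _).le) hi]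
    have : (Function.support fun t : ℝ => Real.exp (-(t ^ α))) = univ := by
      ext t; simp [Real.exp_ne_zero]
    rw [this]
    simp
  have hJκ : J κ = ((∫ t in Ioi (0:ℝ), Real.exp (-(t ^ α)) : ℝ) : ℂ) * κ ^ ((-(1 / α) : ℝ) : ℂ) := by
    rw [← hJ1, ← hconst]
    push_cast
    rw [Complex.cpow_neg]
    have : κ ^ (1 / (α : ℂ)) ≠ 0 := by
      rw [Ne, Complex.cpow_eq_zero_iff]; tauto
    field_simp
  change 0 < (J κ).re
  rw [hJκ, Complex.re_ofReal_mul, Complex.cpow_ofReal_re]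
  have harg := Complex.abs_arg_lt_pi_div_two_iff.2 (Or.inl hκ)
  have hn : 0 < ‖κ‖ := norm_pos_iff.2 hκ0
  have hcos : 0 < Real.cos (κ.arg * (-(1 / α))) := by
    apply Real.cos_pos_of_mem_Ioo
    have h1 : |κ.arg * (-(1 / α))| < Real.pi / 2 := by
      rw [abs_mul, abs_neg, abs_of_pos (show 0 < 1 / α by positivity)]
      have : 1 / α ≤ 1 := by rw [div_le_one (by linarith)]; exact hα.le
      nlinarith [abs_nonneg κ.arg]
    exact ⟨(abs_lt.1 h1).1, (abs_lt.1 h1).2⟩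
  positivity

end

end

section

open Filter Set

noncomputable section

open MeasureTheory

theorem cc_scaled (μ : ℕ → ℝ) (hnn : ∀ j, 0 ≤ μ j) (hs : HasSum μ 1) (N r : ℕ) (a : ℝ) (ha : 0 < a) :
    a * cc μ N r = Real.pi⁻¹ * ∫ t in Ioi (0:ℝ), (Ioc 0 (Real.pi * a)).indicator
      (fun t => (FF μ (t / a) ^ N * Complex.exp (-((t / a * r : ℝ) * Complex.I))).re) t := by
  have h := intervalIntegral.integral_comp_div (a := 0) (b := Real.pi * a) (c := a)
    (fun s => (FF μ s ^ N * Complex.exp (-((s * r : ℝ) * Complex.I))).re) ha.ne'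
  rw [zero_div, mul_div_cancel_right₀ _ ha.ne', ← cc_fourier μ hnn hs, 
    intervalIntegral.integral_of_le (by positivity)] at h
  rw [setIntegral_indicator measurableSet_Ioc]
  have : Ioi (0:ℝ) ∩ Ioc 0 (Real.pi * a) = Ioc 0 (Real.pi * a) := by
    apply inter_eq_self_of_subset_right; intro t ht; exact ht.1
  rw [this, h]
  have := Real.pi_pos
  simp only [smul_eq_mul]
  field_simp

theorem llt (μ : ℕ → ℝ) (hnn : ∀ j, 0 ≤ μ j) (hs : HasSum μ 1) (a : ℕ → ℝ)
    (ha : Tendsto a atTop atTop) (α : ℝ) (hα : 1 < α) (κ : ℂ) (c : ℝ) (hc : 0 < c)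
    (h1 : ∀ t : ℝ, 0 < t → Tendsto (fun n : ℕ => (n : ℂ) *
      (FF μ (t / a n) * Complex.exp (-((t / a n : ℝ) * Complex.I)) - 1)) atTop
      (nhds (-κ * ((t ^ α : ℝ) : ℂ))))
    (h2 : ∀ᶠ n : ℕ in atTop, ∀ t : ℝ, 2 ≤ t → t ≤ Real.pi * a n →
      ‖FF μ (t / a n)‖ ^ n ≤ Real.exp (-c * t)) :
    (∃ D : ℝ, 0 < D ∧ ∀ j : ℕ, Tendsto (fun n => a n * cc μ n (n - j)) atTop (nhds D)) ∧
    ∃ C : ℝ, ∀ᶠ n : ℕ in atTop, ∀ r, a n * cc μ n r ≤ C := by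
  have hlim : ∀ t : ℝ, 0 < t → Tendsto (fun n : ℕ =>
      (FF μ (t / a n) * Complex.exp (-((t / a n : ℝ) * Complex.I))) ^ n) atTop
      (nhds (Complex.exp (-κ * ((t ^ α : ℝ) : ℂ)))) := by
    intro t ht
    have := Complex.tendsto_one_add_pow_exp_of_tendsto (h1 t ht)
    simpa using this
  have hnorm1 : ∀ x : ℝ, ‖Complex.exp (-((x : ℝ) * Complex.I))‖ = 1 := by
    intro x
    have := Complex.norm_exp_ofReal_mul_I (-x)
    simpa using this
  have hpi := Real.pi_gt_three
  have hκ : 0 < κ.re := by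
    have hl := (hlim 2 two_pos).norm
    have hb : ‖Complex.exp (-κ * (((2:ℝ) ^ α : ℝ) : ℂ))‖ ≤ Real.exp (-c * 2) := by
      refine le_of_tendsto hl ?_
      filter_upwards [h2, ha.eventually_ge_atTop 1] with n hn han
      rw [norm_pow, norm_mul, hnorm1, mul_one]
      exact hn 2 le_rfl (by nlinarith)
    rw [J_norm, Real.exp_le_exp] at hb
    have : (0:ℝ) < 2 ^ α := by positivity
    by_contra hneg
    push Not at hneg
    nlinarith
  have hbound : ∀ᶠ n : ℕ in atTop, ∀ t : ℝ, 0 < t → t ≤ Real.pi * a n →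
      ‖FF μ (t / a n)‖ ^ n ≤ Real.exp (2 * c) * Real.exp (-c * t) := by
    filter_upwards [h2] with n hn t ht hta
    rcases le_total 2 t with h | h
    · refine (hn t h hta).trans ?_
      have : 1 ≤ Real.exp (2 * c) := Real.one_le_exp (by linarith)
      nlinarith [Real.exp_pos (-c * t)]
    · refine (pow_le_one₀ (norm_nonneg _) (norm_FF_le_one μ hnn hs _)).trans ?_
      rw [← Real.exp_add]
      exact Real.one_le_exp (by nlinarith)
  have hint : Integrable (fun t : ℝ => Real.exp (2 * c) * Real.exp (-c * t))
      (volume.restrict (Ioi 0)) := (exp_neg_integrableOn_Ioi 0 hc).const_mul _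
  have hbound2 : ∀ᶠ n : ℕ in atTop, ∀ r : ℕ, ∀ᵐ t : ℝ ∂(volume.restrict (Ioi 0)),
      ‖(Ioc 0 (Real.pi * a n)).indicator
      (fun t => (FF μ (t / a n) ^ n * Complex.exp (-((t / a n * r : ℝ) * Complex.I))).re) t‖
        ≤ Real.exp (2 * c) * Real.exp (-c * t) := by
    filter_upwards [hbound] with n hn r
    refine Eventually.of_forall fun t => ?_
    by_cases ht : t ∈ Ioc 0 (Real.pi * a n)
    · rw [indicator_of_mem ht]
      refine (Complex.abs_re_le_norm _).trans ?_
      rw [norm_mul, hnorm1, mul_one, norm_pow]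
      exact hn t ht.1 ht.2
    · rw [indicator_of_notMem ht, norm_zero]; positivity
  have hmeas : ∀ n r : ℕ, AEStronglyMeasurable ((Ioc 0 (Real.pi * a n)).indicator
      (fun t => (FF μ (t / a n) ^ n * Complex.exp (-((t / a n * r : ℝ) * Complex.I))).re))
      (volume.restrict (Ioi 0)) := by
    intro n r
    have hF := continuous_FF μ hnn hs
    exact (Continuous.aestronglyMeasurable (by fun_prop)).indicator measurableSet_Ioc
  refine ⟨⟨Real.pi⁻¹ * (∫ t in Ioi (0:ℝ), Complex.exp (-κ * ((t ^ α : ℝ) : ℂ))).re,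
    mul_pos (by positivity) (J_pos α hα κ hκ), fun j => ?_⟩, ?_⟩
  · have hre : (∫ t in Ioi (0:ℝ), Complex.exp (-κ * ((t ^ α : ℝ) : ℂ))).re =
        ∫ t in Ioi (0:ℝ), (Complex.exp (-κ * ((t ^ α : ℝ) : ℂ))).re :=
      (integral_re (J_integrable' α hα κ hκ)).symm
    rw [hre]
    have hev : (fun n => a n * cc μ n (n - j)) =ᶠ[atTop] fun n => Real.pi⁻¹ *
        ∫ t in Ioi (0:ℝ), (Ioc 0 (Real.pi * a n)).indicator
      (fun t => (FF μ (t / a n) ^ n * Complex.exp (-((t / a n * (n - j : ℕ) : ℝ) * Complex.I))).re) t := by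
      filter_upwards [ha.eventually_gt_atTop 0] with n hn
      exact cc_scaled μ hnn hs n (n - j) (a n) hn
    rw [tendsto_congr' hev]
    refine Tendsto.const_mul _ ?_
    refine tendsto_integral_filter_of_dominated_convergence _
      (Eventually.of_forall fun n => hmeas n (n - j)) ?_ hint ?_
    · filter_upwards [hbound2] with n hn
      exact hn (n - j)
    · filter_upwards [ae_restrict_mem measurableSet_Ioi] with t ht
      have ht0 : (0:ℝ) < t := ht
      have hexp : Tendsto (fun n => Complex.exp ((t / a n * j : ℝ) * Complex.I)) atTop (nhds 1) := by
        have h0 : Tendsto (fun n => t / a n * j) atTop (nhds 0) := by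
          simpa using (ha.const_div_atTop t).mul_const (j : ℝ)
        have : Continuous fun x : ℝ => Complex.exp ((x : ℂ) * Complex.I) := by fun_prop
        have h := (this.tendsto 0).comp h0
        simp only [Complex.ofReal_zero, zero_mul, Complex.exp_zero] at h
        exact h
      have h3 := ((hlim t ht0).mul hexp)
      rw [mul_one] at h3
      have h4 := (Complex.continuous_re.tendsto _).comp h3
      refine h4.congr' ?_
      filter_upwards [ha.eventually_ge_atTop t, eventually_ge_atTop j] with n hn hnj
      have hmem : t ∈ Ioc 0 (Real.pi * a n) := ⟨ht0, by nlinarith⟩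
      rw [indicator_of_mem hmem]
      simp only [Function.comp]
      congr 1
      rw [mul_pow, mul_assoc]
      congr 1
      rw [← Complex.exp_nat_mul, ← Complex.exp_add]
      congr 1
      rw [Nat.cast_sub hnj]
      push_cast
      ring
  · refine ⟨Real.pi⁻¹ * ∫ t in Ioi (0:ℝ), Real.exp (2 * c) * Real.exp (-c * t), ?_⟩
    filter_upwards [hbound2, ha.eventually_gt_atTop 0] with n hn han r
    rw [cc_scaled μ hnn hs n r (a n) han]
    refine mul_le_mul_of_nonneg_left ?_ (by positivity)
    refine integral_mono_ae (Integrable.mono' hint (hmeas n r) (hn r)) hint ?_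
    filter_upwards [hn r] with t ht
    exact (le_abs_self _).trans ht

end

end

section

open Filter Set

noncomputable section

theorem R_pos (μ : ℕ → ℝ) (hnn : ∀ j, 0 ≤ μ j) (hs : HasSum μ 1)
    (haper : ∀ d : ℕ, (∀ i : ℕ, 0 < i → 0 < μ i → d ∣ i) → d = 1)
    (s : ℝ) (h0 : 0 < s) (hπ : s ≤ Real.pi) : 0 < 1 - (FF μ s).re := by
  have hS := hasSum_re μ hnn hs s
  have hterm : ∀ k : ℕ, 0 ≤ μ k * (1 - Real.cos (s * k)) := fun k =>
    mul_nonneg (hnn k) (by linarith [Real.cos_le_one (s * k)])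
  rcases (hS.nonneg hterm).lt_or_eq with h | h
  · exact h
  exfalso
  rw [← h] at hS
  have hz := (hasSum_zero_iff_of_nonneg hterm).1 hS
  let H : AddSubgroup ℤ := (AddSubgroup.zmultiples (2 * Real.pi)).comap
    ((AddMonoidHom.mulLeft s).comp (Int.castAddHom ℝ))
  have hmem : ∀ z : ℤ, z ∈ H ↔ ∃ m : ℤ, m • (2 * Real.pi) = s * z := by
    intro z
    simp only [H, AddSubgroup.mem_comap, AddSubgroup.mem_zmultiples_iff]
    rfl
  obtain ⟨d, hd⟩ := Int.subgroup_cyclic H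
  have hd1 : d.natAbs = 1 := by
    apply haper
    intro i hi hμi
    have h1 := congrFun hz i
    have h2 : Real.cos (s * i) = 1 := by
      simp only [Pi.zero_apply] at h1
      rcases mul_eq_zero.1 h1 with h | h
      · linarith
      · linarith
    obtain ⟨m, hm⟩ := (Real.cos_eq_one_iff _).1 h2
    have h3 : (i : ℤ) ∈ H := by
      rw [hmem]
      exact ⟨m, by rw [zsmul_eq_mul, hm]; push_cast; rfl⟩
    rw [hd, AddSubgroup.mem_closure_singleton] at h3
    obtain ⟨q, hq⟩ := h3
    rw [← Int.natCast_dvd_natCast, Int.natCast_natAbs]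
    rw [abs_dvd]
    exact ⟨q, by rw [← hq, smul_eq_mul, mul_comm]⟩
  have h4 : (1 : ℤ) ∈ H := by
    rw [hd, AddSubgroup.mem_closure_singleton]
    rcases Int.natAbs_eq d with h | h <;> rw [hd1] at h
    · exact ⟨1, by rw [h]; simp⟩
    · exact ⟨-1, by rw [h]; simp⟩
  rw [hmem] at h4
  obtain ⟨m, hm⟩ := h4
  rw [zsmul_eq_mul, Int.cast_one, mul_one] at hm
  have hpi := Real.pi_pos
  have hm0 : (0 : ℝ) < m := by
    by_contra hcon
    push Not at hcon
    nlinarith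
  have hm1 : (1 : ℝ) ≤ m := by
    have : (0 : ℤ) < m := by exact_mod_cast hm0
    exact_mod_cast this
  nlinarith

theorem R_compact (μ : ℕ → ℝ) (hnn : ∀ j, 0 ≤ μ j) (hs : HasSum μ 1)
    (haper : ∀ d : ℕ, (∀ i : ℕ, 0 < i → 0 < μ i → d ∣ i) → d = 1)
    (δ : ℝ) (h0 : 0 < δ) : ∃ η > 0, ∀ s, δ ≤ s → s ≤ Real.pi → η ≤ 1 - (FF μ s).re := by
  rcases lt_or_ge Real.pi δ with h | h
  · exact ⟨1, one_pos, fun s h1 h2 => by linarith⟩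
  have hc : ContinuousOn (fun s => 1 - (FF μ s).re) (Icc δ Real.pi) := by
    have := continuous_FF μ hnn hs
    exact (continuous_const.sub (Complex.continuous_re.comp this)).continuousOn
  obtain ⟨x, hx, hmin⟩ := isCompact_Icc.exists_isMinOn (nonempty_Icc.2 h) hc
  refine ⟨_, R_pos μ hnn hs haper x (h0.trans_le hx.1) hx.2, fun s h1 h2 => ?_⟩
  exact hmin (a := s) ⟨h1, h2⟩

theorem h2_of (μ : ℕ → ℝ) (hnn : ∀ j, 0 ≤ μ j) (hs : HasSum μ 1) (hpos : 0 < μ 0)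
    (haper : ∀ d : ℕ, (∀ i : ℕ, 0 < i → 0 < μ i → d ∣ i) → d = 1)
    (a : ℕ → ℝ) (ha : Tendsto a atTop atTop) (δ c0 C : ℝ) (hδ : 0 < δ) (hc0 : 0 < c0)
    (hC : 0 < C) (haC : ∀ᶠ n in atTop, a n ≤ C * n)
    (hR : ∀ᶠ n : ℕ in atTop, ∀ t, 2 ≤ t → t ≤ δ * a n →
      c0 * t ≤ n * (1 - (FF μ (t / a n)).re)) :
    ∃ c > 0, ∀ᶠ n : ℕ in atTop, ∀ t, 2 ≤ t → t ≤ Real.pi * a n →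
      ‖FF μ (t / a n)‖ ^ n ≤ Real.exp (-c * t) := by
  obtain ⟨η, hη, hηR⟩ := R_compact μ hnn hs haper δ hδ
  have hpi := Real.pi_pos
  refine ⟨μ 0 * min c0 (η / (Real.pi * C)), by positivity, ?_⟩
  filter_upwards [haC, hR, ha.eventually_gt_atTop 0] with n h1 h2 han t ht2 htπ
  have key : min c0 (η / (Real.pi * C)) * t ≤ n * (1 - (FF μ (t / a n)).re) := by
    rcases le_or_gt t (δ * a n) with h | h
    · refine le_trans ?_ (h2 t ht2 h)
      exact mul_le_mul_of_nonneg_right (min_le_left _ _) (by linarith)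
    · have h3 := hηR (t / a n) (by rw [le_div_iff₀ han]; exact h.le)
        (by rw [div_le_iff₀ han]; exact htπ)
      have h4 : (η / (Real.pi * C)) * t ≤ n * η := by
        rw [div_mul_eq_mul_div, div_le_iff₀ (by positivity)]
        have : t ≤ Real.pi * (C * n) := htπ.trans (mul_le_mul_of_nonneg_left h1 hpi.le)
        nlinarith
      have h5 : (n : ℝ) * η ≤ n * (1 - (FF μ (t / a n)).re) :=
        mul_le_mul_of_nonneg_left h3 (Nat.cast_nonneg n)
      refine le_trans (mul_le_mul_of_nonneg_right (min_le_right _ _) (by linarith)) (h4.trans h5)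
  set R := 1 - (FF μ (t / a n)).re with hRdef
  have h6 : ‖FF μ (t / a n)‖ ≤ Real.exp (-(μ 0 * R)) :=
    (norm_FF_le μ hnn hs (t / a n)).trans (by
      have := Real.add_one_le_exp (-(μ 0 * R)); linarith)
  calc ‖FF μ (t / a n)‖ ^ n ≤ Real.exp (-(μ 0 * R)) ^ n := pow_le_pow_left₀ (norm_nonneg _) h6 n
    _ = Real.exp (n * (-(μ 0 * R))) := (Real.exp_nat_mul _ _).symm
    _ ≤ _ := by
      apply Real.exp_le_exp.2
      have := mul_le_mul_of_nonneg_left key hpos.le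
      nlinarith

end

end

section

open Filter Set

noncomputable section

/-- Second order remainder of `exp (i x)`. -/
def hh (x : ℝ) : ℂ := Complex.exp ((x : ℂ) * Complex.I) - 1 - (x : ℂ) * Complex.I

theorem norm_hh_le (x : ℝ) : ‖hh x‖ ≤ 3 * x ^ 2 := by
  have hn : ‖(x : ℂ) * Complex.I‖ = |x| := by simp
  rcases le_or_gt |x| 1 with h | h
  · have := Complex.norm_exp_sub_one_sub_id_le (x := (x : ℂ) * Complex.I) (by rw [hn]; exact h)
    rw [hn, sq_abs] at this
    unfold hh
    nlinarith [sq_nonneg x]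
  · have h1 : ‖hh x‖ ≤ 1 + 1 + |x| := by
      unfold hh
      refine (norm_sub_le _ _).trans ?_
      rw [hn]
      gcongr
      refine (norm_sub_le _ _).trans ?_
      rw [Complex.norm_exp_ofReal_mul_I]; simp
    have : x ^ 2 = |x| ^ 2 := (sq_abs x).symm
    nlinarith

theorem norm_hh_le3 (x : ℝ) (hx : |x| ≤ 1) : ‖hh x + (x : ℂ) ^ 2 / 2‖ ≤ |x| ^ 3 := by
  have hn : ‖(x : ℂ) * Complex.I‖ = |x| := by simp
  have := Complex.exp_bound (x := (x : ℂ) * Complex.I) (by rw [hn]; exact hx) (n := 3) (by norm_num)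
  rw [hn] at this
  have e : hh x + (x : ℂ) ^ 2 / 2 = Complex.exp ((x : ℂ) * Complex.I) -
      ∑ m ∈ Finset.range 3, ((x : ℂ) * Complex.I) ^ m / (m.factorial : ℂ) := by
    unfold hh
    simp [Finset.sum_range_succ, Nat.factorial, mul_pow]
    ring
  rw [e]
  refine this.trans ?_
  have h3 : 0 ≤ |x| ^ 3 := by positivity
  norm_num [Nat.factorial]
  nlinarith

theorem hasSum_hh (μ : ℕ → ℝ) (hnn : ∀ j, 0 ≤ μ j) (hs : HasSum μ 1)
    (hcrit : HasSum (fun j : ℕ => (j : ℝ) * μ j) 1) (s : ℝ) :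
    HasSum (fun k : ℕ => (μ k : ℂ) * hh (s * (k - 1)))
      (FF μ s * Complex.exp (-((s : ℝ) * Complex.I)) - 1) := by
  have h1 := (hasSum_FF μ hnn hs s).mul_right (Complex.exp (-((s : ℝ) * Complex.I)))
  have h2 : HasSum (fun k => (μ k : ℂ)) 1 := by
    have := Complex.hasSum_ofReal.2 hs
    rwa [Complex.ofReal_one] at this
  have h3 : HasSum (fun j : ℕ => ((j : ℂ) * μ j)) 1 := by
    have := Complex.hasSum_ofReal.2 hcrit
    simpa using this
  have h4 := (h1.sub h2).sub ((h3.sub h2).mul_left ((s : ℂ) * Complex.I))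
  rw [sub_self, mul_zero, sub_zero] at h4
  refine h4.congr_fun ?_
  intro k
  unfold hh
  have : Complex.exp ((s * (k - 1) : ℝ) * Complex.I) = Complex.exp ((s * k : ℝ) * Complex.I) *
      Complex.exp (-((s : ℝ) * Complex.I)) := by
    rw [← Complex.exp_add]; congr 1; push_cast; ring
  rw [this]
  push_cast
  ring

theorem hh_lim (y : ℝ) : Tendsto (fun n : ℕ => (n : ℂ) * hh (y / √n)) atTop
    (nhds (-(y : ℂ) ^ 2 / 2)) := by
  have ha : Tendsto (fun n : ℕ => √(n : ℝ)) atTop atTop :=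
    Real.tendsto_sqrt_atTop.comp tendsto_natCast_atTop_atTop
  rw [tendsto_iff_norm_sub_tendsto_zero]
  have h0 : Tendsto (fun n : ℕ => |y| ^ 3 / √(n : ℝ)) atTop (nhds 0) := ha.const_div_atTop _
  refine squeeze_zero' (Eventually.of_forall fun n => norm_nonneg _) ?_ h0
  filter_upwards [ha.eventually_ge_atTop |y|, ha.eventually_gt_atTop 0] with n h1 h2
  have hsq : √(n : ℝ) ^ 2 = n := Real.sq_sqrt (Nat.cast_nonneg n)
  have hb := norm_hh_le3 (y / √n) (by rw [abs_div, abs_of_pos h2, div_le_one h2]; exact h1)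
  have e : (n : ℂ) * hh (y / √n) - (-(y : ℂ) ^ 2 / 2) =
      (n : ℂ) * (hh (y / √n) + ((y / √n : ℝ) : ℂ) ^ 2 / 2) := by
    have hc : ((√(n : ℝ) : ℝ) : ℂ) ^ 2 = n := by exact_mod_cast congrArg (fun x : ℝ => (x : ℂ)) hsq
    have hc0 : ((√(n : ℝ) : ℝ) : ℂ) ≠ 0 := by exact_mod_cast h2.ne'
    push_cast
    rw [div_pow, mul_add, ← hc]
    field_simp
    ring
  rw [e, norm_mul, Complex.norm_natCast]
  calc (n : ℝ) * _ ≤ n * |y / √n| ^ 3 := by gcongr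
    _ = |y| ^ 3 / √n := by
      rw [abs_div, abs_of_pos h2, div_pow]
      nth_rewrite 1 [← hsq]
      field_simp

theorem case_var (μ : ℕ → ℝ) (hnn : ∀ j, 0 ≤ μ j) (hs : HasSum μ 1) (hpos : 0 < μ 0)
    (hcrit : HasSum (fun j : ℕ => (j : ℝ) * μ j) 1)
    (haper : ∀ d : ℕ, (∀ i : ℕ, 0 < i → 0 < μ i → d ∣ i) → d = 1)
    (hvar : Summable fun k : ℕ => (k : ℝ) ^ 2 * μ k) :
    ∃ a : ℕ → ℝ, Tendsto a atTop atTop ∧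
    (∃ D : ℝ, 0 < D ∧ ∀ j : ℕ, Tendsto (fun n => a n * cc μ n (n - j)) atTop (nhds D)) ∧
    ∃ C : ℝ, ∀ᶠ n : ℕ in atTop, ∀ r, a n * cc μ n r ≤ C := by
  have ha : Tendsto (fun n : ℕ => √(n : ℝ)) atTop atTop :=
    Real.tendsto_sqrt_atTop.comp tendsto_natCast_atTop_atTop
  have hpi := Real.pi_pos
  have hk1 : ∃ k1 : ℕ, 0 < k1 ∧ 0 < μ k1 := by
    by_contra hcon
    push Not at hcon
    have : (fun j : ℕ => (j : ℝ) * μ j) = fun _ => 0 := by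
      funext j
      rcases Nat.eq_zero_or_pos j with h | h
      · simp [h]
      · rw [le_antisymm (hcon j h) (hnn j), mul_zero]
    rw [this] at hcrit
    exact zero_ne_one (hasSum_zero.unique hcrit)
  obtain ⟨k1, hk1, hμk1⟩ := hk1
  have hk1' : (0 : ℝ) < k1 := by exact_mod_cast hk1
  have hh2 : ∃ c > 0, ∀ᶠ n : ℕ in atTop, ∀ t, 2 ≤ t → t ≤ Real.pi * √(n : ℝ) →
      ‖FF μ (t / √n)‖ ^ n ≤ Real.exp (-c * t) := by
    refine h2_of μ hnn hs hpos haper (fun n => √(n : ℝ)) ha (Real.pi / k1)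
      (μ k1 * (2 / Real.pi ^ 2 * k1 ^ 2)) 1 (by positivity) (by positivity) one_pos ?_ ?_
    · filter_upwards [eventually_ge_atTop 1] with n hn
      rw [one_mul, Real.sqrt_le_iff]
      have : (1 : ℝ) ≤ n := by exact_mod_cast hn
      constructor <;> nlinarith
    · filter_upwards [ha.eventually_gt_atTop 0] with n hn t ht2 ht
      have hle := le_hasSum (hasSum_re μ hnn hs (t / √n)) k1 (fun k _ =>
        mul_nonneg (hnn k) (by linarith [Real.cos_le_one (t / √n * k)]))
      have hsq : √(n : ℝ) ^ 2 = n := Real.sq_sqrt (Nat.cast_nonneg n)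
      have hcos := Real.cos_le_one_sub_mul_cos_sq (x := t / √n * k1) (by
        rw [abs_of_nonneg (by positivity)]
        rw [div_mul_eq_mul_div, div_le_iff₀ hn]
        rw [div_mul_eq_mul_div, le_div_iff₀ hk1'] at ht
        exact ht)
      have h3 : μ k1 * (2 / Real.pi ^ 2 * (t / √n * k1) ^ 2) ≤ 1 - (FF μ (t / √n)).re :=
        le_trans (mul_le_mul_of_nonneg_left (by linarith) (hnn k1)) hle
      have h4 := mul_le_mul_of_nonneg_left h3 (Nat.cast_nonneg (α := ℝ) n)
      refine le_trans ?_ h4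
      have e : (n : ℝ) * (μ k1 * (2 / Real.pi ^ 2 * (t / √n * k1) ^ 2)) =
          (μ k1 * (2 / Real.pi ^ 2 * k1 ^ 2)) * t ^ 2 := by
        nth_rewrite 1 [← hsq]
        field_simp
      rw [e]
      refine mul_le_mul_of_nonneg_left ?_ (by positivity)
      nlinarith
  obtain ⟨c, hc, hh2⟩ := hh2
  have hvs : Summable fun k : ℕ => μ k * ((k : ℝ) - 1) ^ 2 := by
    have := (hvar.sub (hcrit.summable.mul_left 2)).add hs.summable
    refine this.congr ?_
    intro k; ring
  refine ⟨_, ha, llt μ hnn hs _ ha 2 (by norm_num)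
    (((∑' k : ℕ, μ k * ((k : ℝ) - 1) ^ 2) / 2 : ℝ) : ℂ) c hc ?_ hh2⟩
  intro t ht
  have e1 : (fun n : ℕ => (n : ℂ) * (FF μ (t / √n) * Complex.exp (-((t / √n : ℝ) * Complex.I)) - 1))
      = fun n : ℕ => ∑' k : ℕ, (μ k : ℂ) * ((n : ℂ) * hh (t * (k - 1) / √n)) := by
    funext n
    rw [← (hasSum_hh μ hnn hs hcrit (t / √n)).tsum_eq, ← tsum_mul_left]
    refine tsum_congr fun k => ?_
    rw [div_mul_eq_mul_div]
    ring
  rw [e1]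
  have e2 : -(((∑' k : ℕ, μ k * ((k : ℝ) - 1) ^ 2) / 2 : ℝ) : ℂ) * ((t ^ (2 : ℝ) : ℝ) : ℂ) =
      ∑' k : ℕ, (μ k : ℂ) * (-((t * (k - 1) : ℝ) : ℂ) ^ 2 / 2) := by
    have : (∑' k : ℕ, (μ k : ℂ) * (-((t * (k - 1) : ℝ) : ℂ) ^ 2 / 2)) =
        ((∑' k : ℕ, (-t ^ 2 / 2) * (μ k * ((k : ℝ) - 1) ^ 2) : ℝ) : ℂ) := by
      rw [Complex.ofReal_tsum]
      refine tsum_congr fun k => ?_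
      push_cast; ring
    rw [this, tsum_mul_left, Real.rpow_two]
    push_cast
    ring
  rw [e2]
  refine tendsto_tsum_of_dominated_convergence
    (bound := fun k : ℕ => 3 * t ^ 2 * (μ k * ((k : ℝ) - 1) ^ 2)) (hvs.mul_left _) ?_ ?_
  · intro k
    exact (hh_lim (t * (k - 1))).const_mul _
  · filter_upwards [ha.eventually_gt_atTop 0] with n hn k
    have hsq : √(n : ℝ) ^ 2 = n := Real.sq_sqrt (Nat.cast_nonneg n)
    rw [norm_mul, norm_mul, Complex.norm_natCast, Complex.norm_real, Real.norm_of_nonneg (hnn k)]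
    have hb := norm_hh_le (t * (k - 1) / √n)
    calc μ k * (n * _) ≤ μ k * (n * (3 * (t * (k - 1) / √n) ^ 2)) := by
          have := hnn k
          gcongr
      _ = _ := by
        nth_rewrite 1 [← hsq]
        field_simp

end

end

section

open Filter Set

noncomputable section

theorem final_of (μ0 μ : ℕ → ℝ) (m0 : ℝ)
    (hμ0nn : ∀ j, 0 ≤ μ0 j) (hμ00 : μ0 0 = 0) (hμ0sum : HasSum μ0 1)
    (hμ0mean : HasSum (fun j : ℕ => (j : ℝ) * μ0 j) m0)
    (hμnn : ∀ j, 0 ≤ μ j) (hμsum : HasSum μ 1)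
    (a : ℕ → ℝ) (ha : Tendsto a atTop atTop) (D : ℝ) (hD : 0 < D)
    (hlim : ∀ j : ℕ, Tendsto (fun n => a n * cc μ n (n - j)) atTop (nhds D))
    (C : ℝ) (hC : ∀ᶠ n : ℕ in atTop, ∀ r, a n * cc μ n r ≤ C) (k l : ℕ) :
    Tendsto (fun n : ℕ =>
        (∑ᶠ τ ∈ {τ : PlaneTree | τ.verts.card = n ∧ n - 1 - τ.maxSub = k ∧ τ.kc [] = l + 1},
          bgwModW μ0 μ τ) / bgwModMass μ0 μ n)
      atTop (nhds (forestSum μ l k * (((l + 1 : ℕ) : ℝ) * μ0 (l + 1) / m0))) := by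
  have hm0 : 0 < m0 := by
    have : (1 : ℝ) ≤ m0 := by
      refine hasSum_le ?_ hμ0sum hμ0mean
      intro j
      rcases Nat.eq_zero_or_pos j with h | h
      · simp [h, hμ00]
      · have : (1 : ℝ) ≤ j := by exact_mod_cast h
        nlinarith [hμ0nn j]
    linarith
  set b : ℕ → ℝ := fun n => cc μ n (n - 1) with hb
  have hapos : ∀ᶠ n in atTop, 0 < a n := ha.eventually_gt_atTop 0
  have hab : ∀ᶠ n in atTop, D / 2 < a n * b n :=
    (hlim 1).eventually_const_lt (by linarith)
  have hbpos : ∀ᶠ n in atTop, 0 < b n := by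
    filter_upwards [hapos, hab] with n h1 h2
    by_contra hcon
    push Not at hcon
    nlinarith
  have hA : ∀ j : ℕ, Tendsto (fun n => cc μ n (n - j) / b n) atTop (nhds 1) := by
    intro j
    have := (hlim j).div (hlim 1) hD.ne'
    rw [div_self hD.ne'] at this
    refine this.congr' ?_
    filter_upwards [hapos] with n hn
    simp only [Pi.div_apply]
    rw [mul_div_mul_left _ _ hn.ne']
  obtain ⟨C', hC'0, hB⟩ : ∃ C' : ℝ, 0 < C' ∧ ∀ᶠ n in atTop, ∀ r, cc μ n r / b n ≤ C' := by
    refine ⟨(|C| + 1) / (D / 2), by positivity, ?_⟩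
    filter_upwards [hapos, hab, hC, hbpos] with n h1 h2 h3 h4 r
    rw [div_le_div_iff₀ h4 (by positivity)]
    have h5 : a n * cc μ n r ≤ |C| + 1 := (h3 r).trans (by linarith [le_abs_self C])
    have h6 := cc_nonneg μ hμnn n r
    have h7 : cc μ n r * (D / 2) ≤ cc μ n r * (a n * b n) := mul_le_mul_of_nonneg_left h2.le h6
    nlinarith
  have hdivnn : ∀ᶠ n in atTop, ∀ r, 0 ≤ cc μ n r / b n := by
    filter_upwards [hbpos] with n h4 r
    exact div_nonneg (cc_nonneg μ hμnn n r) h4.le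
  have htree : ∀ n, 1 ≤ n → treeSum μ n = b n / n := by
    intro n hn
    have h1 := lagrange μ n 1 hn
    have h2 : forestSum μ 1 n = treeSum μ n := by
      rw [forestSum_eq_coeff, pow_one, PowerSeries.coeff_mk]
    have : (n : ℝ) ≠ 0 := by positivity
    rw [h2, Nat.cast_one, one_mul] at h1
    rw [eq_div_iff this, mul_comm]; exact h1
  have htpos : ∀ᶠ n in atTop, 0 < treeSum μ n := by
    filter_upwards [hbpos, eventually_ge_atTop 1] with n h1 h2
    rw [htree n h2]
    positivity
  -- mass ratio
  have hmass : Tendsto (fun n => bgwModMass μ0 μ (n + 1) / treeSum μ n) atTop (nhds m0) := by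
    rw [← hμ0mean.tsum_eq]
    have e : (fun n => bgwModMass μ0 μ (n + 1) / treeSum μ n) =ᶠ[atTop] fun n =>
        ∑' j : ℕ, (if j ∈ Finset.range (n + 1) then μ0 j * (j * (cc μ n (n - j) / b n)) else 0) := by
      filter_upwards [hbpos, eventually_ge_atTop 1] with n h1 h2
      rw [modMass_eq, tsum_eq_sum (s := Finset.range (n + 1)), Finset.sum_div]
      · refine Finset.sum_congr rfl fun j hj => ?_
        rw [if_pos hj, htree n h2]
        have hl := lagrange μ n j (by simpa [Nat.lt_succ_iff] using hj)
        have hn0 : (n : ℝ) ≠ 0 := by positivity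
        have : forestSum μ j n = j * cc μ n (n - j) / n := by
          rw [eq_div_iff hn0, mul_comm]; exact hl
        rw [this]
        field_simp
      · intro j hj
        rw [if_neg hj]
    rw [tendsto_congr' e]
    refine tendsto_tsum_of_dominated_convergence
      (bound := fun j : ℕ => C' * ((j : ℝ) * μ0 j)) (hμ0mean.summable.mul_left _) ?_ ?_
    · intro j
      have h1 : Tendsto (fun n => μ0 j * ((j : ℝ) * (cc μ n (n - j) / b n))) atTop
          (nhds (μ0 j * (j * 1))) := ((hA j).const_mul _).const_mul _
      rw [mul_one, mul_comm] at h1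
      refine h1.congr' ?_
      filter_upwards [eventually_ge_atTop j] with n hn
      rw [if_pos (by simpa [Nat.lt_succ_iff] using hn)]
    · filter_upwards [hB, hdivnn] with n h1 h2 j
      have h3 := hμ0nn j
      split_ifs
      · rw [Real.norm_of_nonneg (mul_nonneg h3 (mul_nonneg (Nat.cast_nonneg j) (h2 _)))]
        have := mul_le_mul_of_nonneg_left (h1 (n - j)) (mul_nonneg (Nat.cast_nonneg (α := ℝ) j) h3)
        nlinarith
      · rw [norm_zero]; positivity
  -- successive ratio
  have hbr : Tendsto (fun n => b (n + 1) / b n) atTop (nhds 1) := by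
    rw [← hμsum.tsum_eq]
    have e : (fun n => b (n + 1) / b n) = fun n =>
        ∑' i : ℕ, (if i ∈ Finset.range (n + 1) then μ i * (cc μ n (n - i) / b n) else 0) := by
      funext n
      rw [tsum_eq_sum (s := Finset.range (n + 1))]
      · simp only [hb, Nat.add_sub_cancel]
        rw [cc_succ, Finset.Nat.sum_antidiagonal_eq_sum_range_succ (fun i j => μ i * cc μ n j),
          Finset.sum_div]
        refine Finset.sum_congr rfl fun j hj => ?_
        rw [if_pos hj, mul_div_assoc]
      · intro j hj
        rw [if_neg hj]
    rw [e]
    refine tendsto_tsum_of_dominated_convergence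
      (bound := fun j : ℕ => C' * μ j) (hμsum.summable.mul_left _) ?_ ?_
    · intro j
      have h1 : Tendsto (fun n => μ j * (cc μ n (n - j) / b n)) atTop
          (nhds (μ j * 1)) := ((hA j).const_mul _)
      rw [mul_one] at h1
      refine h1.congr' ?_
      filter_upwards [eventually_ge_atTop j] with n hn
      rw [if_pos (by simpa [Nat.lt_succ_iff] using hn)]
    · filter_upwards [hB, hdivnn] with n h1 h2 j
      have h3 := hμnn j
      split_ifs
      · rw [Real.norm_of_nonneg (mul_nonneg h3 (h2 _))]
        have := mul_le_mul_of_nonneg_left (h1 (n - j)) h3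
        linarith
      · rw [norm_zero]; positivity
  have htr : Tendsto (fun n => treeSum μ n / treeSum μ (n + 1)) atTop (nhds 1) := by
    have h1 := (hbr.inv₀ one_ne_zero).mul (tendsto_natCast_div_add_atTop (1 : ℝ) |>.inv₀ one_ne_zero)
    rw [inv_one, mul_one] at h1
    refine h1.congr' ?_
    filter_upwards [eventually_ge_atTop 1] with n hn
    rw [htree n hn, htree (n + 1) (by omega)]
    have : (n : ℝ) ≠ 0 := by positivity
    push_cast
    simp only [inv_div]
    rw [div_div_div_eq, div_mul_div_comm]
    congr 1
    ring
  have htk : ∀ k : ℕ, Tendsto (fun n => treeSum μ n / treeSum μ (n + k)) atTop (nhds 1) := by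
    intro k
    induction k with
    | zero =>
      refine tendsto_const_nhds.congr' ?_
      filter_upwards [htpos] with n hn
      rw [add_zero, div_self hn.ne']
    | succ k ih =>
      have h2 := ih.mul (htr.comp (tendsto_add_atTop_nat k))
      rw [mul_one] at h2
      refine h2.congr' ?_
      filter_upwards [(tendsto_add_atTop_nat k).eventually htpos] with n hn
      simp only [Function.comp]
      rw [add_assoc]
      rw [div_mul_div_cancel₀ hn.ne']
  rw [← tendsto_add_atTop_iff_nat (k + 1)]
  have hfin := ((htk k).mul_const (forestSum μ l k * (((l + 1 : ℕ) : ℝ) * μ0 (l + 1)))).div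
    (hmass.comp (tendsto_add_atTop_nat k)) hm0.ne'
  rw [one_mul, mul_div_assoc] at hfin
  refine hfin.congr' ?_
  filter_upwards [(tendsto_add_atTop_nat k).eventually htpos, eventually_gt_atTop k] with n hn hnk
  have e := numerator_eq μ0 μ k l (n + k) (by omega)
  simp only [mem_ofPred_eq] at e
  rw [← add_assoc, e, Nat.add_sub_cancel]
  simp only [Function.comp, Pi.div_apply]
  rw [div_mul_eq_mul_div, div_div_div_cancel_right₀ hn.ne']
  congr 1
  ring

end

end

section

open Filter Set

noncomputable section

/-- Real tail function of `μ`. -/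
def TT (μ : ℕ → ℝ) (x : ℝ) : ℝ := ∑' k : ℕ, {m : ℕ | x ≤ m}.indicator μ k

theorem TT_summable (μ : ℕ → ℝ) (hs : HasSum μ 1) (x : ℝ) :
    Summable ({m : ℕ | x ≤ m}.indicator μ) := hs.summable.indicator _

theorem TT_antitone (μ : ℕ → ℝ) (hnn : ∀ j, 0 ≤ μ j) (hs : HasSum μ 1) : Antitone (TT μ) := by
  intro x y hxy
  refine (TT_summable μ hs y).tsum_le_tsum ?_ (TT_summable μ hs x)
  intro k
  refine indicator_le_indicator_of_subset ?_ hnn k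
  intro m hm
  exact le_trans hxy hm

theorem TT_nonneg (μ : ℕ → ℝ) (hnn : ∀ j, 0 ≤ μ j) (x : ℝ) : 0 ≤ TT μ x :=
  tsum_nonneg fun k => indicator_nonneg (fun j _ => hnn j) k

theorem TT_le_one (μ : ℕ → ℝ) (hnn : ∀ j, 0 ≤ μ j) (hs : HasSum μ 1) (x : ℝ) : TT μ x ≤ 1 := by
  rw [← hs.tsum_eq]
  refine (TT_summable μ hs x).tsum_le_tsum ?_ hs.summable
  intro k
  exact indicator_le_self' (fun j _ => hnn j) k

theorem TT_markov (μ : ℕ → ℝ) (hnn : ∀ j, 0 ≤ μ j) (hs : HasSum μ 1)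
    (hcrit : HasSum (fun j : ℕ => (j : ℝ) * μ j) 1) (x : ℝ) : x * TT μ x ≤ 1 := by
  rw [← hcrit.tsum_eq, TT, ← tsum_mul_left]
  refine ((TT_summable μ hs x).mul_left x).tsum_le_tsum ?_ hcrit.summable
  intro k
  by_cases h : x ≤ k
  · rw [indicator_of_mem (by exact h)]
    exact mul_le_mul_of_nonneg_right h (hnn k)
  · rw [indicator_of_notMem (by exact h), mul_zero]
    exact mul_nonneg (Nat.cast_nonneg k) (hnn k)

theorem TT_nat (μ : ℕ → ℝ) (n : ℕ) :
    TT μ n = ∑' k : ℕ, {m : ℕ | n ≤ m}.indicator μ k := by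
  unfold TT
  simp only [Nat.cast_le]

section RV
variable (μ : ℕ → ℝ) (α : ℝ) (g : ℝ → ℝ)

theorem TT_pos (hnn : ∀ j, 0 ≤ μ j) (hs : HasSum μ 1) (hg : ∀ x : ℝ, 0 < x → 0 < g x)
    (htail : ∀ n : ℕ, 1 ≤ n → (∑' k : ℕ, {m : ℕ | n ≤ m}.indicator μ k) = g n * (n : ℝ) ^ (-α))
    (x : ℝ) : 0 < TT μ x := by
  have h1 : x ≤ (⌈x⌉₊ + 1 : ℕ) := (Nat.le_ceil x).trans (by push_cast; linarith)
  refine lt_of_lt_of_le ?_ (TT_antitone μ hnn hs h1)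
  rw [TT_nat, htail _ (by omega)]
  have := hg (⌈x⌉₊ + 1 : ℕ) (by positivity)
  positivity

theorem TT_nat_ratio
    (hgs : ∀ c : ℝ, 0 < c → Tendsto (fun x => g (c * x) / g x) atTop (nhds 1))
    (htail : ∀ n : ℕ, 1 ≤ n → (∑' k : ℕ, {m : ℕ | n ≤ m}.indicator μ k) = g n * (n : ℝ) ^ (-α))
    (p q : ℕ) (hp : 0 < p) (hq : 0 < q) :
    Tendsto (fun r : ℕ => TT μ (p * r : ℕ) / TT μ (q * r : ℕ)) atTop
      (nhds (((p : ℝ) / q) ^ (-α))) := by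
  have hp' : (0 : ℝ) < p := by exact_mod_cast hp
  have hq' : (0 : ℝ) < q := by exact_mod_cast hq
  have h1 : Tendsto (fun r : ℕ => (q : ℝ) * r) atTop atTop :=
    tendsto_natCast_atTop_atTop.const_mul_atTop hq'
  have h2 := ((hgs (p / q) (by positivity)).comp h1).mul_const (((p : ℝ) / q) ^ (-α))
  rw [one_mul] at h2
  refine h2.congr' ?_
  filter_upwards [eventually_ge_atTop 1] with r hr
  have hr' : (0 : ℝ) < r := by exact_mod_cast hr
  rw [TT_nat, TT_nat, htail _ (Nat.mul_pos hp hr), htail _ (Nat.mul_pos hq hr)]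
  simp only [Function.comp]
  push_cast
  have e : (p : ℝ) / q * (q * r) = p * r := by field_simp
  rw [e, mul_div_mul_comm]
  congr 1
  rw [← Real.div_rpow (by positivity) (by positivity)]
  congr 1
  field_simp

theorem TT_rv (hnn : ∀ j, 0 ≤ μ j) (hs : HasSum μ 1) (hg : ∀ x : ℝ, 0 < x → 0 < g x)
    (hgs : ∀ c : ℝ, 0 < c → Tendsto (fun x => g (c * x) / g x) atTop (nhds 1))
    (htail : ∀ n : ℕ, 1 ≤ n → (∑' k : ℕ, {m : ℕ | n ≤ m}.indicator μ k) = g n * (n : ℝ) ^ (-α))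
    (c : ℝ) (hc : 0 < c) :
    Tendsto (fun x => TT μ (c * x) / TT μ x) atTop (nhds (c ^ (-α))) := by
  have hpos := TT_pos μ α g hnn hs hg htail
  have hanti := TT_antitone μ hnn hs
  have hcont : ContinuousAt (fun x : ℝ => x ^ (-α)) c :=
    Real.continuousAt_rpow_const _ _ (Or.inl hc.ne')
  have hrat : ∀ z : ℚ, 0 < z → ∃ p q : ℕ, 0 < p ∧ 0 < q ∧ (z : ℝ) = (p : ℝ) / q := by
    intro z hz
    refine ⟨z.num.toNat, z.den, ?_, z.den_pos, ?_⟩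
    · have := Rat.num_pos.2 hz
      omega
    · have := Rat.num_pos.2 hz
      have h : ((z.num.toNat : ℕ) : ℝ) = ((z.num : ℤ) : ℝ) := by
        have : ((z.num.toNat : ℕ) : ℤ) = z.num := Int.toNat_of_nonneg this.le
        exact_mod_cast this
      rw [h]
      exact_mod_cast (Rat.num_div_den z).symm
  rw [tendsto_order]
  constructor
  · intro u hu
    -- rational above `c`
    have hev := hcont.eventually_const_lt hu
    obtain ⟨ε, hε, hball⟩ := Metric.eventually_nhds_iff.1 hev
    obtain ⟨z, hz1, hz2⟩ := exists_rat_btwn (show c < c + ε by linarith)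
    obtain ⟨p, q, hp, hq, hzpq⟩ := hrat z (by exact_mod_cast hc.trans hz1)
    have hp' : (0 : ℝ) < p := by exact_mod_cast hp
    have hq' : (0 : ℝ) < q := by exact_mod_cast hq
    have hu2 : u < ((p : ℝ) / q) ^ (-α) := by
      rw [← hzpq]
      apply hball
      rw [Real.dist_eq, abs_of_pos (by linarith)]; linarith
    have hr := (TT_nat_ratio μ α g hgs htail p q hp hq).eventually_const_lt hu2
    have hfl : Tendsto (fun x : ℝ => ⌊x / q⌋₊) atTop atTop :=
      tendsto_nat_floor_atTop.comp (tendsto_id.atTop_div_const hq')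
    rw [hzpq] at hz1
    filter_upwards [hfl.eventually hr, eventually_ge_atTop (p / (p / q - c)), eventually_ge_atTop 0]
      with x h1 h2 hx0
    refine h1.trans_le ?_
    have hfloor : (⌊x / q⌋₊ : ℝ) ≤ x / q := Nat.floor_le (by positivity)
    have hfloor2 : x / q < (⌊x / q⌋₊ : ℝ) + 1 := Nat.lt_floor_add_one _
    have h3 : ((q * ⌊x / q⌋₊ : ℕ) : ℝ) ≤ x := by
      push_cast
      calc (q : ℝ) * _ ≤ q * (x / q) := by gcongr
        _ = x := by field_simp
    have h4 : c * x ≤ ((p * ⌊x / q⌋₊ : ℕ) : ℝ) := by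
      push_cast
      rw [div_le_iff₀ (by linarith)] at h2
      have h5 : (p : ℝ) * (x / q - 1) ≤ p * ⌊x / q⌋₊ := by gcongr; linarith
      have h6 : (p : ℝ) * (x / q - 1) = p / q * x - p := by field_simp
      nlinarith
    exact div_le_div₀ (hpos _).le (hanti h4) (hpos _) (hanti h3)
  · intro u hu
    have hev := hcont.eventually_lt_const hu
    obtain ⟨ε, hε, hball⟩ := Metric.eventually_nhds_iff.1 hev
    obtain ⟨z, hz1, hz2⟩ := exists_rat_btwn (show max 0 (c - ε) < c by
      apply max_lt hc; linarith)
    obtain ⟨p, q, hp, hq, hzpq⟩ := hrat z (by exact_mod_cast (le_max_left _ _).trans_lt hz1)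
    have hz1' := (le_max_right _ _).trans_lt hz1
    have hp' : (0 : ℝ) < p := by exact_mod_cast hp
    have hq' : (0 : ℝ) < q := by exact_mod_cast hq
    have hu2 : ((p : ℝ) / q) ^ (-α) < u := by
      rw [← hzpq]
      apply hball
      rw [Real.dist_eq, abs_of_neg (by linarith)]; linarith
    have hr := (TT_nat_ratio μ α g hgs htail p q hp hq).eventually_lt_const hu2
    have hfl : Tendsto (fun x : ℝ => ⌊x / q⌋₊ + 1) atTop atTop :=
      (tendsto_add_atTop_nat 1).comp
        (tendsto_nat_floor_atTop.comp (tendsto_id.atTop_div_const hq'))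
    rw [hzpq] at hz2
    filter_upwards [hfl.eventually hr, eventually_ge_atTop (p / (c - p / q)), eventually_ge_atTop 0]
      with x h1 h2 hx0
    refine lt_of_le_of_lt ?_ h1
    have hfloor : (⌊x / q⌋₊ : ℝ) ≤ x / q := Nat.floor_le (by positivity)
    have hfloor2 : x / q < (⌊x / q⌋₊ : ℝ) + 1 := Nat.lt_floor_add_one _
    have h3 : x ≤ ((q * (⌊x / q⌋₊ + 1) : ℕ) : ℝ) := by
      push_cast
      calc x = q * (x / q) := by field_simp
        _ ≤ _ := by gcongr
    have h4 : ((p * (⌊x / q⌋₊ + 1) : ℕ) : ℝ) ≤ c * x := by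
      push_cast
      rw [div_le_iff₀ (by linarith)] at h2
      have h5 : (p : ℝ) * (⌊x / q⌋₊ + 1) ≤ p * (x / q + 1) := by gcongr
      have h6 : (p : ℝ) * (x / q + 1) = p / q * x + p := by field_simp
      nlinarith
    exact div_le_div₀ (hpos _).le (hanti h4) (hpos _) (hanti h3)

end RV

end

end

section

open Filter Set

noncomputable section

theorem potter (T : ℝ → ℝ) (α β γ : ℝ) (hanti : Antitone T) (hpos : ∀ x, 0 < T x)
    (hrv : Tendsto (fun x => T (2 * x) / T x) atTop (nhds ((2 : ℝ) ^ (-α))))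
    (hβ : β < α) (hγ : α < γ) (hβ0 : 0 < β) :
    ∃ x0 : ℝ, 0 < x0 ∧ ∀ x, x0 ≤ x → T (2 * x) ≤ (2 : ℝ) ^ (-β) * T x ∧
      ∀ y, 1 ≤ y → T (y * x) ≤ (y / 2) ^ (-β) * T x ∧ (2 * y) ^ (-γ) * T x ≤ T (y * x) := by
  have h1 : (2 : ℝ) ^ (-γ) < (2 : ℝ) ^ (-α) := Real.rpow_lt_rpow_of_exponent_lt (by norm_num) (by linarith)
  have h2 : (2 : ℝ) ^ (-α) < (2 : ℝ) ^ (-β) := Real.rpow_lt_rpow_of_exponent_lt (by norm_num) (by linarith)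
  have hev := (hrv.eventually_const_lt h1).and (hrv.eventually_lt_const h2)
  obtain ⟨x0, hx0⟩ := eventually_atTop.1 hev
  refine ⟨max x0 1, by positivity, ?_⟩
  have hstep : ∀ x, max x0 1 ≤ x → (2 : ℝ) ^ (-γ) * T x ≤ T (2 * x) ∧
      T (2 * x) ≤ (2 : ℝ) ^ (-β) * T x := by
    intro x hx
    obtain ⟨h3, h4⟩ := hx0 x ((le_max_left _ _).trans hx)
    rw [lt_div_iff₀ (hpos x)] at h3
    rw [div_lt_iff₀ (hpos x)] at h4
    exact ⟨h3.le, h4.le⟩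
  have hiter : ∀ m : ℕ, ∀ x, max x0 1 ≤ x → ((2 : ℝ) ^ m) ^ (-γ) * T x ≤ T (2 ^ m * x) ∧
      T (2 ^ m * x) ≤ ((2 : ℝ) ^ m) ^ (-β) * T x := by
    intro m
    induction m with
    | zero => intro x hx; simp
    | succ m ih =>
      intro x hx
      obtain ⟨h3, h4⟩ := ih x hx
      have hx1 : 1 ≤ x := (le_max_right _ _).trans hx
      have hxm : max x0 1 ≤ 2 ^ m * x := hx.trans (by
        have : (1 : ℝ) ≤ 2 ^ m := one_le_pow₀ (by norm_num)
        nlinarith)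
      obtain ⟨h5, h6⟩ := hstep _ hxm
      have e : (2 : ℝ) ^ (m + 1) * x = 2 * (2 ^ m * x) := by ring
      have e2 : ∀ δ : ℝ, ((2 : ℝ) ^ (m + 1)) ^ δ = 2 ^ δ * (2 ^ m) ^ δ := by
        intro δ
        rw [pow_succ', Real.mul_rpow (by norm_num) (by positivity)]
      rw [e, e2, e2, mul_assoc, mul_assoc]
      constructor
      · exact le_trans (mul_le_mul_of_nonneg_left h3 (by positivity)) h5
      · exact h6.trans (mul_le_mul_of_nonneg_left h4 (by positivity))
  intro x hx
  refine ⟨(hstep x hx).2, ?_⟩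
  intro y hy
  have hx1 : 1 ≤ x := (le_max_right _ _).trans hx
  obtain ⟨m, hm1, hm2⟩ := exists_nat_pow_near hy (show (1 : ℝ) < 2 by norm_num)
  have hTx := hpos x
  constructor
  · calc T (y * x) ≤ T (2 ^ m * x) := hanti (mul_le_mul_of_nonneg_right hm1 (by linarith))
      _ ≤ ((2 : ℝ) ^ m) ^ (-β) * T x := (hiter m x hx).2
      _ ≤ (y / 2) ^ (-β) * T x := by
        refine mul_le_mul_of_nonneg_right ?_ hTx.le
        refine Real.rpow_le_rpow_of_nonpos (by positivity) ?_ (by linarith)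
        rw [pow_succ] at hm2
        linarith
  · calc (2 * y) ^ (-γ) * T x ≤ ((2 : ℝ) ^ (m + 1)) ^ (-γ) * T x := by
          refine mul_le_mul_of_nonneg_right ?_ hTx.le
          refine Real.rpow_le_rpow_of_nonpos (by positivity) ?_ (by linarith)
          rw [pow_succ]
          linarith
      _ ≤ T (2 ^ (m + 1) * x) := (hiter (m + 1) x hx).1
      _ ≤ T (y * x) := hanti (mul_le_mul_of_nonneg_right hm2.le (by linarith))

/-- Bound on the tail at small arguments. -/
theorem potter_small (T : ℝ → ℝ) (γ x0 : ℝ) (hpos : ∀ x, 0 < T x)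
    (hle : ∀ x, T x ≤ 1) (hγ : 0 < γ) (hx0 : 0 < x0)
    (hp : ∀ x, x0 ≤ x → ∀ y, 1 ≤ y → (2 * y) ^ (-γ) * T x ≤ T (y * x)) (x y : ℝ) (hx : x0 ≤ x)
    (hy0 : 0 < y) (hy1 : y ≤ 1) :
    T (x * y) ≤ ((2 : ℝ) ^ γ / T x0) * y ^ (-γ) * T x := by
  have hx' : 0 < x := hx0.trans_le hx
  rcases le_or_gt x0 (x * y) with h | h
  · have h1 := hp (x * y) h (1 / y) (by rw [le_div_iff₀ hy0]; linarith)
    have e : 1 / y * (x * y) = x := by field_simp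
    rw [e] at h1
    have e2 : (2 * (1 / y)) ^ (-γ) = (2 : ℝ) ^ (-γ) * y ^ γ := by
      rw [Real.mul_rpow (by norm_num) (by positivity), one_div, Real.inv_rpow hy0.le,
        Real.rpow_neg hy0.le, inv_inv]
    rw [e2] at h1
    have h2 : T (x * y) ≤ (2 : ℝ) ^ γ * y ^ (-γ) * T x := by
      have h3 : (2 : ℝ) ^ γ * y ^ (-γ) * ((2 : ℝ) ^ (-γ) * y ^ γ * T (x * y)) = T (x * y) := by
        rw [Real.rpow_neg hy0.le, Real.rpow_neg (by norm_num)]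
        have : y ^ γ ≠ 0 := (Real.rpow_pos_of_pos hy0 γ).ne'
        have : (2 : ℝ) ^ γ ≠ 0 := (Real.rpow_pos_of_pos (by norm_num) γ).ne'
        field_simp
      rw [← h3]
      exact mul_le_mul_of_nonneg_left h1 (by positivity)
    refine h2.trans ?_
    have hTx := hpos x
    have h4 : (2 : ℝ) ^ γ ≤ (2 : ℝ) ^ γ / T x0 := by
      rw [le_div_iff₀ (hpos x0)]
      exact mul_le_of_le_one_right (by positivity) (hle x0)
    gcongr
  · refine (hle _).trans ?_
    have h1 := hp x0 le_rfl (x / x0) (by rw [le_div_iff₀ hx0]; linarith)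
    have e : x / x0 * x0 = x := by field_simp
    rw [e, Real.mul_rpow (by norm_num) (by positivity)] at h1
    have h2 : (x / x0) ^ γ ≤ y ^ (-γ) := by
      rw [Real.rpow_neg hy0.le, ← Real.inv_rpow hy0.le]
      refine Real.rpow_le_rpow (by positivity) ?_ hγ.le
      rw [div_le_iff₀ hx0, inv_mul_eq_div, le_div_iff₀ hy0]
      exact h.le
    have hT0 := hpos x0
    calc (1 : ℝ) = ((2 : ℝ) ^ γ / T x0) * (x / x0) ^ γ *
          ((2 : ℝ) ^ (-γ) * (x / x0) ^ (-γ) * T x0) := by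
          have hxx : 0 < x / x0 := by positivity
          rw [Real.rpow_neg hxx.le, Real.rpow_neg (by norm_num)]
          have : (x / x0) ^ γ ≠ 0 := (Real.rpow_pos_of_pos hxx γ).ne'
          have : (2 : ℝ) ^ γ ≠ 0 := (Real.rpow_pos_of_pos (by norm_num) γ).ne'
          field_simp
      _ ≤ ((2 : ℝ) ^ γ / T x0) * (x / x0) ^ γ * T x :=
          mul_le_mul_of_nonneg_left h1 (by positivity)
      _ ≤ _ := by
          have := hpos x
          gcongr

/-- The normalising sequence. -/
theorem exists_norm_seq (T : ℝ → ℝ) (α : ℝ) (hanti : Antitone T) (hpos : ∀ x, 0 < T x)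
    (hmark : ∀ x, x * T x ≤ 1)
    (hrv : ∀ c, 0 < c → Tendsto (fun x => T (c * x) / T x) atTop (nhds (c ^ (-α)))) :
    ∃ a : ℕ → ℝ, Tendsto a atTop atTop ∧ Tendsto (fun n => n * T (a n)) atTop (nhds 1) ∧
      ∀ᶠ n : ℕ in atTop, 1 ≤ n * T (a n) := by
  have hex : ∀ n : ℕ, ∃ m : ℕ, n * T ((m : ℝ) + 1) < 1 := by
    intro n
    refine ⟨n, ?_⟩
    have h1 := hmark ((n : ℝ) + 1)
    have h2 := hpos ((n : ℝ) + 1)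
    nlinarith
  classical
  let A : ℕ → ℕ := fun n => Nat.find (hex n)
  have hA1 : ∀ n : ℕ, n * T ((A n : ℝ) + 1) < 1 := fun n => Nat.find_spec (hex n)
  have hA2 : ∀ n : ℕ, 1 ≤ A n → 1 ≤ n * T (A n : ℝ) := by
    intro n hn
    have := Nat.find_min (hex n) (m := A n - 1) (Nat.sub_lt hn one_pos)
    push Not at this
    have e : ((A n - 1 : ℕ) : ℝ) + 1 = A n := by
      have := Nat.sub_add_cancel hn
      exact_mod_cast this
    rwa [e] at this
  have hAtop : Tendsto A atTop atTop := by
    rw [tendsto_atTop]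
    intro M
    have h1 : Tendsto (fun n : ℕ => (n : ℝ) * T ((M : ℝ) + 1)) atTop atTop :=
      tendsto_natCast_atTop_atTop.atTop_mul_const (hpos _)
    filter_upwards [h1.eventually_ge_atTop 1] with n hn
    by_contra hcon
    push Not at hcon
    have h2 : T ((M : ℝ) + 1) ≤ T ((A n : ℝ) + 1) := hanti (by
      have : (A n : ℝ) ≤ M := by exact_mod_cast hcon.le
      linarith)
    have h3 := hA1 n
    have h4 := mul_le_mul_of_nonneg_left h2 (Nat.cast_nonneg (α := ℝ) n)
    linarith
  have ha : Tendsto (fun n => (A n : ℝ)) atTop atTop := tendsto_natCast_atTop_atTop.comp hAtop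
  have hge : ∀ᶠ n : ℕ in atTop, 1 ≤ n * T (A n : ℝ) := by
    filter_upwards [hAtop.eventually_ge_atTop 1] with n hn
    exact hA2 n hn
  refine ⟨fun n => A n, ha, ?_, hge⟩
  rw [tendsto_order]
  constructor
  · intro u hu
    filter_upwards [hge] with n hn
    exact hu.trans_le hn
  · intro u hu
    -- choose `c > 1` with `c ^ (-α) > 1 / u`
    have hu0 : 0 < u := by linarith
    have hcont : ContinuousAt (fun x : ℝ => x ^ (-α)) 1 :=
      Real.continuousAt_rpow_const _ _ (Or.inl one_ne_zero)
    have h1u : u⁻¹ < (1 : ℝ) ^ (-α) := by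
      rw [Real.one_rpow]; exact inv_lt_one_of_one_lt₀ hu
    have hev := hcont.eventually_const_lt h1u
    obtain ⟨ε, hε, hball⟩ := Metric.eventually_nhds_iff.1 hev
    have hc : u⁻¹ < (1 + ε / 2) ^ (-α) := by
      apply hball
      rw [Real.dist_eq, add_sub_cancel_left, abs_of_pos (by linarith)]; linarith
    have hr := ha.eventually ((hrv (1 + ε / 2) (by linarith)).eventually_const_lt hc)
    filter_upwards [hr, ha.eventually_ge_atTop (2 / ε)] with n h1 h2
    rw [lt_div_iff₀ (hpos _)] at h1
    have h3 : T ((1 + ε / 2) * (A n : ℝ)) ≤ T ((A n : ℝ) + 1) := hanti (by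
      rw [div_le_iff₀ hε] at h2
      linarith)
    have h4 := hA1 n
    have h5 : u⁻¹ * T (A n : ℝ) ≤ T ((A n : ℝ) + 1) := h1.le.trans h3
    rcases Nat.eq_zero_or_pos n with h | h
    · simp [h, hu0]
    · have hn : (0 : ℝ) < n := by exact_mod_cast h
      have h6 : (n : ℝ) * (u⁻¹ * T (A n : ℝ)) < 1 :=
        (mul_le_mul_of_nonneg_left h5 hn.le).trans_lt h4
      have h7 : (n : ℝ) * (u⁻¹ * T (A n : ℝ)) = (n * T (A n : ℝ)) / u := by field_simp
      rw [h7, div_lt_one hu0] at h6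
      exact h6

end

end

section

open Filter Set

noncomputable section

section
open MeasureTheory

theorem hh_integral (s : ℝ) (k : ℕ) : hh (s * k) = ∫ x in Ioi (0 : ℝ),
    (Iic (k : ℝ)).indicator (fun x : ℝ => (s : ℂ) * Complex.I *
      (Complex.exp ((s * x : ℝ) * Complex.I) - 1)) x := by
  rw [setIntegral_indicator measurableSet_Iic, Ioi_inter_Iic,
    ← intervalIntegral.integral_of_le (Nat.cast_nonneg k)]
  have hderiv : ∀ x ∈ uIcc (0 : ℝ) k, HasDerivAt (fun x : ℝ => hh (s * x))
      ((s : ℂ) * Complex.I * (Complex.exp ((s * x : ℝ) * Complex.I) - 1)) x := by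
    intro x _
    unfold hh
    have h1 : HasDerivAt (fun x : ℝ => ((s * x : ℝ) : ℂ) * Complex.I) ((s : ℂ) * Complex.I) x := by
      have h0 : HasDerivAt (fun x : ℝ => s * x) s x := by
        simpa using (hasDerivAt_id x).const_mul s
      exact h0.ofReal_comp.mul_const _
    have h2 := (h1.cexp.sub_const 1).sub h1
    refine h2.congr_deriv ?_
    ring
  rw [intervalIntegral.integral_eq_sub_of_hasDerivAt hderiv
    (Continuous.intervalIntegrable (by fun_prop) _ _)]
  simp [hh]

theorem norm_exp_sub_one_le (x : ℝ) : ‖Complex.exp ((x : ℝ) * Complex.I) - 1‖ ≤ |x| := by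
  have := Real.norm_exp_I_mul_ofReal_sub_one_le (x := x)
  rwa [mul_comm, Real.norm_eq_abs] at this

theorem norm_exp_sub_one_le_two (x : ℝ) : ‖Complex.exp ((x : ℝ) * Complex.I) - 1‖ ≤ 2 := by
  refine (norm_sub_le _ _).trans ?_
  rw [Complex.norm_exp_ofReal_mul_I, norm_one]; norm_num

theorem tsum_hh_integral (μ : ℕ → ℝ) (hnn : ∀ j, 0 ≤ μ j)
    (hcrit : HasSum (fun j : ℕ => (j : ℝ) * μ j) 1) (s : ℝ) :
    ∑' k : ℕ, (μ k : ℂ) * hh (s * k) = ∫ x in Ioi (0 : ℝ), (TT μ x : ℂ) * ((s : ℂ) * Complex.I *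
      (Complex.exp ((s * x : ℝ) * Complex.I) - 1)) := by
  set G : ℝ → ℂ := fun x => (s : ℂ) * Complex.I * (Complex.exp ((s * x : ℝ) * Complex.I) - 1) with hG
  have hGc : Continuous G := by rw [hG]; fun_prop
  have hGb : ∀ x, ‖G x‖ ≤ |s| * 2 := by
    intro x
    simp only [hG, norm_mul, Complex.norm_real, Complex.norm_I, mul_one, Real.norm_eq_abs]
    exact mul_le_mul_of_nonneg_left (norm_exp_sub_one_le_two _) (abs_nonneg s)
  let F : ℕ → ℝ → ℂ := fun k x => (μ k : ℂ) * (Iic (k : ℝ)).indicator G x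
  have hInt : ∀ k : ℕ, Integrable ((Iic (k : ℝ)).indicator G) (volume.restrict (Ioi 0)) := by
    intro k
    rw [integrable_indicator_iff measurableSet_Iic]
    unfold IntegrableOn
    rw [Measure.restrict_restrict measurableSet_Iic, inter_comm, Ioi_inter_Iic]
    exact hGc.integrableOn_Ioc
  have hFi : ∀ k, Integrable (F k) (volume.restrict (Ioi 0)) := fun k => (hInt k).const_mul _
  have hnormle : ∀ k : ℕ, ∫ x in Ioi (0 : ℝ), ‖F k x‖ ≤ (|s| * 2) * (k * μ k) := by
    intro k
    have e : (fun x => ‖F k x‖) = (Iic (k : ℝ)).indicator (fun x => μ k * ‖G x‖) := by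
      funext x
      simp only [F, norm_mul, Complex.norm_real, Real.norm_of_nonneg (hnn k)]
      rw [norm_indicator_eq_indicator_norm]
      by_cases h : x ∈ Iic (k : ℝ)
      · simp [indicator_of_mem h]
      · simp [indicator_of_notMem h]
    rw [e, setIntegral_indicator measurableSet_Iic, Ioi_inter_Iic]
    have h1 : ∫ x in Ioc (0 : ℝ) k, μ k * ‖G x‖ ≤ ∫ x in Ioc (0 : ℝ) k, μ k * (|s| * 2) := by
      refine setIntegral_mono ?_ ?_ ?_
      · exact (Continuous.integrableOn_Ioc (by fun_prop))
      · exact (Continuous.integrableOn_Ioc (by fun_prop))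
      · intro x
        exact mul_le_mul_of_nonneg_left (hGb x) (hnn k)
    refine h1.trans (le_of_eq ?_)
    rw [setIntegral_const]
    simp
    ring
  have hsum : Summable fun k => ∫ x in Ioi (0 : ℝ), ‖F k x‖ :=
    Summable.of_nonneg_of_le (fun k => integral_nonneg fun x => norm_nonneg _) hnormle
      (hcrit.summable.mul_left _)
  have hmain := hasSum_integral_of_summable_integral_norm hFi hsum
  have e1 : (fun k : ℕ => ∫ x in Ioi (0 : ℝ), F k x) = fun k : ℕ => (μ k : ℂ) * hh (s * k) := by
    funext k
    rw [hh_integral, ← integral_const_mul]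
  rw [e1] at hmain
  rw [hmain.tsum_eq]
  congr 1
  funext x
  unfold TT
  rw [Complex.ofReal_tsum, ← tsum_mul_right]
  refine tsum_congr fun k => ?_
  simp only [F]
  by_cases h : x ≤ (k : ℝ)
  · rw [indicator_of_mem (by exact h), indicator_of_mem (by exact h)]
  · rw [indicator_of_notMem (by exact h), indicator_of_notMem (by exact h)]
    simp

theorem FF_hh (μ : ℕ → ℝ) (hnn : ∀ j, 0 ≤ μ j) (hs : HasSum μ 1)
    (hcrit : HasSum (fun j : ℕ => (j : ℝ) * μ j) 1) (s : ℝ) :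
    FF μ s * Complex.exp (-((s : ℝ) * Complex.I)) - 1 =
      Complex.exp (-((s : ℝ) * Complex.I)) * ((∑' k : ℕ, (μ k : ℂ) * hh (s * k)) - hh s) := by
  have h1 := hasSum_FF μ hnn hs s
  have h2 : HasSum (fun k => (μ k : ℂ)) 1 := by
    have := Complex.hasSum_ofReal.2 hs
    rwa [Complex.ofReal_one] at this
  have h3 : HasSum (fun j : ℕ => ((j : ℂ) * μ j)) 1 := by
    have := Complex.hasSum_ofReal.2 hcrit
    simpa using this
  have h4 := (h1.sub h2).sub (h3.mul_left ((s : ℂ) * Complex.I))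
  have h5 : HasSum (fun k : ℕ => (μ k : ℂ) * hh (s * k))
      (FF μ s - 1 - (s : ℂ) * Complex.I * 1) := by
    refine h4.congr_fun ?_
    intro k
    unfold hh
    push_cast
    ring
  rw [h5.tsum_eq]
  unfold hh
  have : Complex.exp (-((s : ℝ) * Complex.I)) * Complex.exp ((s : ℝ) * Complex.I) = 1 := by
    rw [← Complex.exp_add, neg_add_cancel, Complex.exp_zero]
  linear_combination (-1 : ℂ) * (-this)

theorem scaled_integral (T : ℝ → ℝ) (a t : ℝ) (ha : 0 < a) :
    ∫ x in Ioi (0 : ℝ), (T x : ℂ) * (((t / a : ℝ) : ℂ) * Complex.I *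
      (Complex.exp ((t / a * x : ℝ) * Complex.I) - 1)) =
    ∫ y in Ioi (0 : ℝ), (T (a * y) : ℂ) * ((t : ℂ) * Complex.I *
      (Complex.exp ((t * y : ℝ) * Complex.I) - 1)) := by
  have h := integral_comp_mul_left_Ioi (fun x => (T x : ℂ) * (((t / a : ℝ) : ℂ) * Complex.I *
      (Complex.exp ((t / a * x : ℝ) * Complex.I) - 1))) 0 ha
  rw [mul_zero] at h
  have ha' : (a : ℂ) ≠ 0 := by exact_mod_cast ha.ne'
  have h2 : ∫ x in Ioi (0 : ℝ), (T x : ℂ) * (((t / a : ℝ) : ℂ) * Complex.I *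
      (Complex.exp ((t / a * x : ℝ) * Complex.I) - 1)) = a • ∫ x in Ioi (0 : ℝ),
        (T (a * x) : ℂ) * (((t / a : ℝ) : ℂ) * Complex.I *
      (Complex.exp ((t / a * (a * x) : ℝ) * Complex.I) - 1)) := by
    rw [h, smul_smul, mul_inv_cancel₀ ha.ne', one_smul]
  rw [h2, ← integral_smul]
  congr 1
  funext y
  have e : t / a * (a * y) = t * y := by field_simp
  rw [e, Complex.real_smul]
  push_cast
  field_simp

theorem limit_integral (α t : ℝ) (ht : 0 < t) :
    ∫ y in Ioi (0 : ℝ), ((y ^ (-α) : ℝ) : ℂ) * ((t : ℂ) * Complex.I *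
      (Complex.exp ((t * y : ℝ) * Complex.I) - 1)) =
    (∫ u in Ioi (0 : ℝ), ((u ^ (-α) : ℝ) : ℂ) * (Complex.I *
      (Complex.exp ((u : ℝ) * Complex.I) - 1))) * ((t ^ α : ℝ) : ℂ) := by
  have h := integral_comp_mul_left_Ioi (fun u => ((u ^ (-α) : ℝ) : ℂ) * (Complex.I *
      (Complex.exp ((u : ℝ) * Complex.I) - 1))) 0 ht
  rw [mul_zero] at h
  have ht' : (t : ℂ) ≠ 0 := by exact_mod_cast ht.ne'
  have h2 : (∫ u in Ioi (0 : ℝ), ((u ^ (-α) : ℝ) : ℂ) * (Complex.I *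
      (Complex.exp ((u : ℝ) * Complex.I) - 1))) = t • ∫ x in Ioi (0 : ℝ),
       (((t * x) ^ (-α) : ℝ) : ℂ) * (Complex.I *
      (Complex.exp ((t * x : ℝ) * Complex.I) - 1)) := by
    rw [h, smul_smul, mul_inv_cancel₀ ht.ne', one_smul]
  rw [h2, ← integral_smul, ← integral_mul_const]
  refine setIntegral_congr_fun measurableSet_Ioi fun y hy => ?_
  have hy0 : (0 : ℝ) < y := hy
  rw [Real.mul_rpow ht.le hy0.le, Real.rpow_neg ht.le, Complex.real_smul]
  have hta : ((t ^ α : ℝ) : ℂ) ≠ 0 := by exact_mod_cast (Real.rpow_pos_of_pos ht α).ne'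
  rw [Complex.ofReal_mul (t ^ α)⁻¹, Complex.ofReal_inv]
  field_simp

end

end

end

section

open Filter Set

noncomputable section

section
open MeasureTheory

/-- Convergence of the rescaled integrals. -/
theorem dct_stable (T : ℝ → ℝ) (α β γ x0 C : ℝ) (hanti : Antitone T) (hpos : ∀ x, 0 < T x)
    (hrv : ∀ c, 0 < c → Tendsto (fun x => T (c * x) / T x) atTop (nhds (c ^ (-α))))
    (hβ : 1 < β) (hγ : γ < 2) (hC : 0 < C)
    (hlarge : ∀ x, x0 ≤ x → ∀ y, 1 ≤ y → T (y * x) ≤ (y / 2) ^ (-β) * T x)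
    (hsmall : ∀ x y, x0 ≤ x → 0 < y → y ≤ 1 → T (x * y) ≤ C * y ^ (-γ) * T x)
    (a : ℕ → ℝ) (ha : Tendsto a atTop atTop)
    (hnT : Tendsto (fun n : ℕ => n * T (a n)) atTop (nhds 1)) (t : ℝ) (ht : 0 < t) :
    Tendsto (fun n : ℕ => (n : ℂ) * ∫ y in Ioi (0 : ℝ), (T (a n * y) : ℂ) * ((t : ℂ) * Complex.I *
      (Complex.exp ((t * y : ℝ) * Complex.I) - 1))) atTop
      (nhds (∫ y in Ioi (0 : ℝ), ((y ^ (-α) : ℝ) : ℂ) * ((t : ℂ) * Complex.I *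
      (Complex.exp ((t * y : ℝ) * Complex.I) - 1)))) := by
  simp_rw [← integral_const_mul]
  have hTm : Measurable T := hanti.measurable
  let bd : ℝ → ℝ := fun y => (Ioc (0 : ℝ) 1).indicator (fun y => 2 * C * t ^ 2 * y ^ (1 - γ)) y +
    (Ioi (1 : ℝ)).indicator (fun y => 4 * t * ((1 / 2 : ℝ) ^ (-β)) * y ^ (-β)) y
  have hGn : ∀ y : ℝ, 0 < y → ‖(t : ℂ) * Complex.I * (Complex.exp ((t * y : ℝ) * Complex.I) - 1)‖
      ≤ t * (t * y) ∧ ‖(t : ℂ) * Complex.I * (Complex.exp ((t * y : ℝ) * Complex.I) - 1)‖ ≤ t * 2 := by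
    intro y hy
    rw [norm_mul, norm_mul, Complex.norm_real, Complex.norm_I, mul_one, Real.norm_of_nonneg ht.le]
    constructor
    · refine mul_le_mul_of_nonneg_left ((norm_exp_sub_one_le _).trans (le_of_eq ?_)) ht.le
      exact abs_of_pos (by positivity)
    · exact mul_le_mul_of_nonneg_left (norm_exp_sub_one_le_two _) ht.le
  refine tendsto_integral_filter_of_dominated_convergence bd ?_ ?_ ?_ ?_
  · refine Eventually.of_forall fun n => Measurable.aestronglyMeasurable ?_
    have : Measurable fun y : ℝ => T (a n * y) := hTm.comp (measurable_id.const_mul _)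
    have h2 : Measurable fun y : ℝ => ((t : ℂ) * Complex.I *
      (Complex.exp ((t * y : ℝ) * Complex.I) - 1)) := Continuous.measurable (by fun_prop)
    exact ((Complex.measurable_ofReal.comp this).mul h2).const_mul _
  · have h2 := hnT.eventually_le_const (show (1 : ℝ) < 2 by norm_num)
    filter_upwards [h2, ha.eventually_ge_atTop x0] with n hn1 hn2
    filter_upwards [ae_restrict_mem measurableSet_Ioi] with y hy
    have hy0 : (0 : ℝ) < y := hy
    rw [norm_mul, norm_mul, Complex.norm_natCast, Complex.norm_real, Real.norm_of_nonneg (hpos _).le]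
    obtain ⟨hg1, hg2⟩ := hGn y hy0
    rcases le_or_gt y 1 with h | h
    · have hm1 : y ∈ Ioc (0 : ℝ) 1 := ⟨hy0, h⟩
      have hm2 : y ∉ Ioi (1 : ℝ) := fun h' => absurd h (not_le.2 h')
      simp only [bd]
      rw [indicator_of_mem hm1, indicator_of_notMem hm2, add_zero]
      have h3 := hsmall (a n) y hn2 hy0 h
      calc (n : ℝ) * (T (a n * y) * _) ≤ n * ((C * y ^ (-γ) * T (a n)) * (t * (t * y))) := by
            have := hpos (a n)
            gcongr
        _ = (n * T (a n)) * (C * t ^ 2 * (y ^ (-γ) * y)) := by ring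
        _ ≤ 2 * (C * t ^ 2 * (y ^ (-γ) * y)) := by gcongr
        _ = _ := by
          have : y ^ (1 - γ) = y ^ (-γ) * y := by
            rw [sub_eq_add_neg, add_comm, Real.rpow_add_one hy0.ne']
          rw [this]; ring
    · have hm1 : y ∉ Ioc (0 : ℝ) 1 := fun h' => absurd h'.2 (not_le.2 h)
      have hm2 : y ∈ Ioi (1 : ℝ) := h
      simp only [bd]
      rw [indicator_of_notMem hm1, indicator_of_mem hm2, zero_add]
      have h3 := hlarge (a n) hn2 y h.le
      rw [mul_comm y] at h3
      calc (n : ℝ) * (T (a n * y) * _) ≤ n * (((y / 2) ^ (-β) * T (a n)) * (t * 2)) := by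
            have := hpos (a n)
            gcongr
        _ = (n * T (a n)) * ((y / 2) ^ (-β) * (t * 2)) := by ring
        _ ≤ 2 * ((y / 2) ^ (-β) * (t * 2)) := by gcongr
        _ = _ := by
          rw [div_eq_mul_one_div, Real.mul_rpow hy0.le (by norm_num)]; ring
  · refine Integrable.add ?_ ?_
    · rw [integrable_indicator_iff measurableSet_Ioc]
      unfold IntegrableOn
      rw [Measure.restrict_restrict measurableSet_Ioc]
      have : Ioc (0 : ℝ) 1 ∩ Ioi 0 = Ioc 0 1 := by
        ext y; simp only [mem_inter_iff, mem_Ioc, mem_Ioi]; tauto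
      rw [this]
      refine Integrable.const_mul ?_ _
      have h := intervalIntegral.intervalIntegrable_rpow' (a := 0) (b := 1) (r := 1 - γ) (by linarith)
      rwa [intervalIntegrable_iff_integrableOn_Ioc_of_le zero_le_one] at h
    · rw [integrable_indicator_iff measurableSet_Ioi]
      unfold IntegrableOn
      rw [Measure.restrict_restrict measurableSet_Ioi]
      have : Ioi (1 : ℝ) ∩ Ioi 0 = Ioi 1 := by
        ext y; simp only [mem_inter_iff, mem_Ioi]
        constructor
        · exact fun h => h.1
        · exact fun h => ⟨h, by linarith⟩
      rw [this]
      exact (integrableOn_Ioi_rpow_of_lt (by linarith) one_pos).const_mul _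
  · filter_upwards [ae_restrict_mem measurableSet_Ioi] with y hy
    have hy0 : (0 : ℝ) < y := hy
    have h1 := ((hrv y hy0).comp ha).mul hnT
    rw [mul_one] at h1
    have h2 : Tendsto (fun n : ℕ => (n : ℝ) * T (a n * y)) atTop (nhds (y ^ (-α))) := by
      refine h1.congr ?_
      intro n
      simp only [Function.comp]
      have := (hpos (a n)).ne'
      rw [mul_comm y]
      field_simp
    have h3 := ((Complex.continuous_ofReal.tendsto _).comp h2).mul_const
      ((t : ℂ) * Complex.I * (Complex.exp ((t * y : ℝ) * Complex.I) - 1))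
    refine h3.congr ?_
    intro n
    simp only [Function.comp]
    push_cast
    ring

end

/-- Lower bound for the real part by tails. -/
theorem R_ge_tail (μ : ℕ → ℝ) (hnn : ∀ j, 0 ≤ μ j) (hs : HasSum μ 1) (s X : ℝ) (hX : 0 < X)
    (hsX : s * X = Real.pi / 2) : TT μ X - TT μ (2 * X) ≤ 1 - (FF μ s).re := by
  have h1 := (TT_summable μ hs X).hasSum.sub (TT_summable μ hs (2 * X)).hasSum
  refine hasSum_le ?_ h1 (hasSum_re μ hnn hs s)
  intro k
  have hpi := Real.pi_pos
  have hs0 : 0 < s := by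
    by_contra hcon
    push Not at hcon
    nlinarith
  have hnonneg : 0 ≤ μ k * (1 - Real.cos (s * k)) :=
    mul_nonneg (hnn k) (by linarith [Real.cos_le_one (s * k)])
  by_cases h2 : 2 * X ≤ k
  · have h3 : X ≤ k := by linarith
    rw [indicator_of_mem (by exact h3), indicator_of_mem (by exact h2), sub_self]
    exact hnonneg
  · have h2' : k ∉ {m : ℕ | 2 * X ≤ (m : ℝ)} := h2
    rw [indicator_of_notMem h2', sub_zero]
    by_cases h3 : X ≤ k
    · rw [indicator_of_mem (by exact h3)]
      have hc : Real.cos (s * k) ≤ 0 := by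
        refine Real.cos_nonpos_of_pi_div_two_le_of_le ?_ ?_
        · rw [← hsX]; exact mul_le_mul_of_nonneg_left h3 hs0.le
        · push Not at h2
          have := mul_le_mul_of_nonneg_left h2.le hs0.le
          linarith
      nlinarith [hnn k]
    · rw [indicator_of_notMem (by exact h3)]
      exact hnonneg

theorem case_stable (μ : ℕ → ℝ) (α : ℝ) (g : ℝ → ℝ) (hnn : ∀ j, 0 ≤ μ j) (hs : HasSum μ 1)
    (hpos0 : 0 < μ 0) (hcrit : HasSum (fun j : ℕ => (j : ℝ) * μ j) 1)
    (haper : ∀ d : ℕ, (∀ i : ℕ, 0 < i → 0 < μ i → d ∣ i) → d = 1)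
    (hα1 : 1 < α) (hα2 : α < 2)
    (hg : ∀ x : ℝ, 0 < x → 0 < g x)
    (hgs : ∀ c : ℝ, 0 < c → Tendsto (fun x => g (c * x) / g x) atTop (nhds 1))
    (htail : ∀ n : ℕ, 1 ≤ n → (∑' k : ℕ, {m : ℕ | n ≤ m}.indicator μ k) = g n * (n : ℝ) ^ (-α)) :
    ∃ a : ℕ → ℝ, Tendsto a atTop atTop ∧
    (∃ D : ℝ, 0 < D ∧ ∀ j : ℕ, Tendsto (fun n => a n * cc μ n (n - j)) atTop (nhds D)) ∧
    ∃ C : ℝ, ∀ᶠ n : ℕ in atTop, ∀ r, a n * cc μ n r ≤ C := by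
  have hpi := Real.pi_pos
  have hpos := TT_pos μ α g hnn hs hg htail
  have hanti := TT_antitone μ hnn hs
  have hrv := TT_rv μ α g hnn hs hg hgs htail
  have hmark := TT_markov μ hnn hs hcrit
  have hle := TT_le_one μ hnn hs
  set T := TT μ with hT
  obtain ⟨β, hβ1, hβα⟩ := exists_between hα1
  obtain ⟨γ, hγα, hγ2⟩ := exists_between hα2
  obtain ⟨x0, hx0, hpot⟩ := potter T α β γ hanti hpos (hrv 2 (by norm_num)) hβα hγα (by linarith)
  obtain ⟨a, ha, hnT, hge⟩ := exists_norm_seq T α hanti hpos hmark hrv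
  have hsmall := potter_small T γ x0 hpos hle (by linarith) hx0
    (fun x hx y hy => ((hpot x hx).2 y hy).2)
  have hdct := dct_stable T α β γ x0 _ hanti hpos hrv hβ1 hγ2
    (div_pos (Real.rpow_pos_of_pos two_pos γ) (hpos x0))
    (fun x hx y hy => ((hpot x hx).2 y hy).1) (fun x y hx h0 h1 => hsmall x y hx h0 h1) a ha hnT
  -- `a n ≤ n`
  have han : ∀ᶠ n in atTop, a n ≤ 1 * n := by
    filter_upwards [hge] with n hn
    have h1 := hmark (a n)
    have h2 : a n * T (a n) ≤ n * T (a n) := h1.trans hn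
    rw [one_mul]
    exact le_of_mul_le_mul_right h2 (hpos _)
  -- `n / a n ^ 2 → 0`
  have hna : Tendsto (fun n : ℕ => (n : ℝ) / a n ^ 2) atTop (nhds 0) := by
    have hlow : Tendsto (fun n : ℕ => a n ^ 2 * T (a n)) atTop atTop := by
      have h1 : Tendsto (fun n : ℕ => ((2 / x0) ^ (-γ) * T x0) * (a n) ^ (2 - γ)) atTop atTop :=
        ((tendsto_rpow_atTop (by linarith)).comp ha).const_mul_atTop
          (mul_pos (Real.rpow_pos_of_pos (by positivity) _) (hpos x0))
      refine tendsto_atTop_mono' _ ?_ h1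
      filter_upwards [ha.eventually_ge_atTop x0] with n hn
      have ha0 : 0 < a n := hx0.trans_le hn
      have h2 := ((hpot x0 le_rfl).2 (a n / x0) (by rw [le_div_iff₀ hx0]; linarith)).2
      have e1 : a n / x0 * x0 = a n := by field_simp
      have e2 : 2 * (a n / x0) = (2 / x0) * a n := by ring
      rw [e1, e2, Real.mul_rpow (by positivity) ha0.le] at h2
      have e3 : a n ^ (2 - γ) = a n ^ 2 * a n ^ (-γ) := by
        rw [sub_eq_add_neg, Real.rpow_add ha0, Real.rpow_two]
      rw [e3]
      calc _ = a n ^ 2 * ((2 / x0) ^ (-γ) * a n ^ (-γ) * T x0) := by ring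
        _ ≤ _ := mul_le_mul_of_nonneg_left h2 (by positivity)
    have h3 := hnT.mul hlow.inv_tendsto_atTop
    rw [mul_zero] at h3
    refine h3.congr' ?_
    filter_upwards [ha.eventually_gt_atTop 0] with n hn
    have := (hpos (a n)).ne'
    simp only [Pi.inv_apply]
    field_simp
  have hh2 : ∃ c > 0, ∀ᶠ n : ℕ in atTop, ∀ t, 2 ≤ t → t ≤ Real.pi * a n →
      ‖FF μ (t / a n)‖ ^ n ≤ Real.exp (-c * t) := by
    have h2β : (2 : ℝ) ^ (-β) < 1 := Real.rpow_lt_one_of_one_lt_of_neg (by norm_num) (by linarith)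
    have hc1 : 0 < 1 - (2 : ℝ) ^ (-β) := by linarith
    refine h2_of μ hnn hs hpos0 haper a ha (Real.pi / (2 * x0))
      ((1 - (2 : ℝ) ^ (-β)) * ((2 : ℝ) ^ (-β) * (2 / Real.pi))) 1 (by positivity)
      (by positivity) one_pos han ?_
    filter_upwards [hge, ha.eventually_gt_atTop 0] with n hn ha0 t ht2 ht
    have ht0 : 0 < t := by linarith
    set X := Real.pi * a n / (2 * t) with hX
    have hX0 : 0 < X := by positivity
    have hXx : x0 ≤ X := by
      rw [hX, le_div_iff₀ (by positivity)]
      rw [div_mul_eq_mul_div, le_div_iff₀ (by positivity)] at ht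
      linarith
    have h1 := R_ge_tail μ hnn hs (t / a n) X hX0 (by rw [hX]; field_simp)
    have h2 := (hpot X hXx).1
    have hy1 : 1 ≤ 2 * t / Real.pi := by
      rw [le_div_iff₀ hpi]
      linarith [Real.pi_le_four]
    have h3 := ((hpot X hXx).2 (2 * t / Real.pi) hy1).1
    have e1 : 2 * t / Real.pi * X = a n := by rw [hX]; field_simp
    rw [e1, div_eq_mul_one_div, Real.mul_rpow (by positivity) (by norm_num)] at h3
    have h4 : (2 * t / Real.pi) ^ (-β) ≤ (2 * t / Real.pi)⁻¹ := by
      rw [← Real.rpow_neg_one]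
      exact Real.rpow_le_rpow_of_exponent_le hy1 (by linarith)
    have h5 : ((1 : ℝ) / 2) ^ (-β) = ((2 : ℝ) ^ (-β))⁻¹ := by
      rw [one_div, Real.inv_rpow (by norm_num)]
    have h2βpos : 0 < (2 : ℝ) ^ (-β) := by positivity
    have h6 : T (a n) ≤ (2 * t / Real.pi)⁻¹ * ((2 : ℝ) ^ (-β))⁻¹ * T X := by
      rw [h5] at h3
      refine h3.trans ?_
      have := hpos X
      gcongr
    have h7 : (2 * t / Real.pi) * (2 : ℝ) ^ (-β) * T (a n) ≤ T X := by
      have := mul_le_mul_of_nonneg_left h6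
        (show 0 ≤ (2 * t / Real.pi) * (2 : ℝ) ^ (-β) by positivity)
      refine this.trans (le_of_eq ?_)
      field_simp
    have h8 : (1 - (2 : ℝ) ^ (-β)) * T X ≤ 1 - (FF μ (t / a n)).re := by
      refine le_trans ?_ h1
      rw [sub_mul, one_mul]
      linarith
    calc (1 - (2 : ℝ) ^ (-β)) * ((2 : ℝ) ^ (-β) * (2 / Real.pi)) * t
        = (1 - (2 : ℝ) ^ (-β)) * ((2 * t / Real.pi) * (2 : ℝ) ^ (-β) * 1) := by ring
      _ ≤ (1 - (2 : ℝ) ^ (-β)) * ((2 * t / Real.pi) * (2 : ℝ) ^ (-β) * (n * T (a n))) := by gcongr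
      _ = n * ((1 - (2 : ℝ) ^ (-β)) * ((2 * t / Real.pi) * (2 : ℝ) ^ (-β) * T (a n))) := by ring
      _ ≤ n * ((1 - (2 : ℝ) ^ (-β)) * T X) := by gcongr
      _ ≤ _ := by gcongr
  obtain ⟨c, hc, hh2⟩ := hh2
  refine ⟨a, ha, llt μ hnn hs a ha α hα1
    (-∫ u in Ioi (0 : ℝ), ((u ^ (-α) : ℝ) : ℂ) * (Complex.I *
      (Complex.exp ((u : ℝ) * Complex.I) - 1))) c hc ?_ hh2⟩
  intro t ht
  have h1 := hdct t ht
  rw [limit_integral α t ht] at h1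
  rw [neg_neg]
  have hexp : Tendsto (fun n => Complex.exp (-((t / a n : ℝ) * Complex.I))) atTop (nhds 1) := by
    have h0 : Tendsto (fun n => t / a n) atTop (nhds 0) := ha.const_div_atTop t
    have : Continuous fun x : ℝ => Complex.exp (-((x : ℂ) * Complex.I)) := by fun_prop
    have h := (this.tendsto 0).comp h0
    simp only [Complex.ofReal_zero, zero_mul, neg_zero, Complex.exp_zero] at h
    exact h
  have hrem : Tendsto (fun n : ℕ => (n : ℂ) * hh (t / a n)) atTop (nhds 0) := by
    rw [tendsto_zero_iff_norm_tendsto_zero]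
    have h0 := hna.const_mul (3 * t ^ 2)
    rw [mul_zero] at h0
    refine squeeze_zero (fun n => norm_nonneg _) ?_ h0
    intro n
    rw [norm_mul, Complex.norm_natCast]
    refine (mul_le_mul_of_nonneg_left (norm_hh_le _) (Nat.cast_nonneg n)).trans (le_of_eq ?_)
    rw [div_pow]; ring
  have h2 := hexp.mul (h1.sub hrem)
  rw [one_mul, sub_zero] at h2
  refine h2.congr' ?_
  filter_upwards [ha.eventually_gt_atTop 0] with n hn
  rw [FF_hh μ hnn hs hcrit, tsum_hh_integral μ hnn hcrit, scaled_integral (TT μ) (a n) t hn]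
  ring

end

end

/-- **Proposition 23.** Let `μ_∅` be a probability measure on `{1,2,…}` with
finite mean `m₀` and `μ` a critical aperiodic probability measure on `ℤ₊` in the domain of
attraction of a stable law of index `α ∈ (1,2]`. Denoting by `M` the size of the largest
subtree grafted on a child of the root and by `N₀` the number of children of the root, for
all fixed `k ≥ 0` and `L ≥ 1`,
`BGW_n^{μ_∅,μ}(n-1-M = k, N₀ = L) → ℙ(Y₁+⋯+Y_{L-1} = k) · L μ_∅(L)/m₀` as `n → ∞`, where the
`Y_i` are i.i.d. with the law of the total size of a `BGW^μ` tree (the first factor being the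
mass given to total size `k` by a forest of `L-1` independent `BGW^μ` trees). -/
theorem largest_root_subtree_joint_convergence (μ0 μ : ℕ → ℝ) (m0 α : ℝ)
    (hμ0nn : ∀ j, 0 ≤ μ0 j) (hμ00 : μ0 0 = 0) (hμ0sum : HasSum μ0 1)
    (hμ0mean : HasSum (fun j : ℕ => (j : ℝ) * μ0 j) m0)
    (hμnn : ∀ j, 0 ≤ μ j) (hμsum : HasSum μ 1)
    (hμpos : 0 < μ 0) (hμ01 : μ 0 + μ 1 < 1)
    (hcrit : HasSum (fun j : ℕ => (j : ℝ) * μ j) 1)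
    (haper : ∀ d : ℕ, (∀ i : ℕ, 0 < i → 0 < μ i → d ∣ i) → d = 1)
    (hα1 : 1 < α) (hα2 : α ≤ 2) (hdom : DomAttr μ α)
    (k L : ℕ) (hL : 1 ≤ L) :
    Tendsto (fun n : ℕ =>
        (∑ᶠ τ ∈ {τ : PlaneTree | τ.verts.card = n ∧ n - 1 - τ.maxSub = k ∧ τ.kc [] = L},
          bgwModW μ0 μ τ) / bgwModMass μ0 μ n)
      atTop
      (nhds ((∑ᶠ G ∈ {G : Fin (L - 1) → PlaneTree | (∑ i, (G i).verts.card) = k},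
        ∏ i, bgwW μ (G i)) * ((L : ℝ) * μ0 L / m0))) := by
  obtain ⟨l, rfl⟩ : ∃ l, L = l + 1 := ⟨L - 1, by omega⟩
  have hex : ∃ a : ℕ → ℝ, Tendsto a atTop atTop ∧
      (∃ D : ℝ, 0 < D ∧ ∀ j : ℕ, Tendsto (fun n => a n * cc μ n (n - j)) atTop (nhds D)) ∧
      ∃ C : ℝ, ∀ᶠ n : ℕ in atTop, ∀ r, a n * cc μ n r ≤ C := by
    rcases hdom with ⟨_, hvar⟩ | ⟨hlt, g, hg, hgs, htail⟩
    · exact case_var μ hμnn hμsum hμpos hcrit haper hvar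
    · exact case_stable μ α g hμnn hμsum hμpos hcrit haper hα1 hlt hg hgs htail
  obtain ⟨a, ha, ⟨D, hD, hlim⟩, C, hC⟩ := hex
  exact final_of μ0 μ m0 hμ0nn hμ00 hμ0sum hμ0mean hμnn hμsum a ha D hD hlim C hC k l

end
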